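/- Two-layer random network setup: fix an integer c ≥ 2. For positive integers d and n, let W¹ be an n×d random matrix with i.i.d. N(0,1/d) entries and W² a c×n random matrix with i.i.d. N(0,1/n) entries, independent of each other. Given (W¹,W²), for an input x ~ N(0, I_d) on ℝ^d define the n×n diagonal matrix D = D(x) with D_ii = 1 if (W¹x)_i ≥ 0 and D_ii = 0 otherwise; y = σ(W¹x) with σ the entrywise ReLU; z = W²y ∈ ℝ^c; p = softmax(z); A = A(x) = diag(p) − p pᵀ; and the output Hessian M = M(W¹,W²) = E_x[ D (W²)ᵀ A W² D ], an n×n symmetric positive semidefinite matrix (expectation taken entrywise over x only). Then for every ε > 0, lim_{n→∞} lim_{d→∞} P_{(W¹,W²)}[ | ‖W² M (W²)ᵀ‖_F² / ‖M‖_F² − 1 | > ε ] = 0; that is, with probability tending to 1, ‖W² M (W²)ᵀ‖_F² / ‖M‖_F² → 1, so projecting M onto the row span of W² preserves its Frobenius norm. -/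

import Mathlib

open MeasureTheory ProbabilityTheory Filter Matrix
open scoped NNReal ENNReal

/-- The standard Gaussian input distribution `N(0, I_d)` on `ℝ^d`. -/
noncomputable def inputMeasure (d : ℕ) : Measure (Fin d → ℝ) :=
  Measure.pi fun _ => gaussianReal 0 1

/-- The joint law of the two weight matrices: `W¹` is `n × d` with i.i.d. `N(0, 1/d)`
entries and, independently, `W²` is `c × n` with i.i.d. `N(0, 1/n)` entries. -/
noncomputable def weightMeasure (c d n : ℕ) :
    Measure (((Fin n × Fin d) → ℝ) × ((Fin c × Fin n) → ℝ)) :=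
  (Measure.pi fun _ : Fin n × Fin d => gaussianReal 0 (d : ℝ≥0)⁻¹).prod
    (Measure.pi fun _ : Fin c × Fin n => gaussianReal 0 (n : ℝ≥0)⁻¹)

/-- First-layer weights as an `n × d` matrix. -/
def W1of {n d : ℕ} (w : (Fin n × Fin d) → ℝ) : Matrix (Fin n) (Fin d) ℝ :=
  Matrix.of fun i j => w (i, j)

/-- Second-layer weights as a `c × n` matrix. -/
def W2of {c n : ℕ} (w : (Fin c × Fin n) → ℝ) : Matrix (Fin c) (Fin n) ℝ :=
  Matrix.of fun i j => w (i, j)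

/-- The softmax function on `ℝ^c`. -/
noncomputable def softmaxFn {c : ℕ} (z : Fin c → ℝ) : Fin c → ℝ :=
  fun i => Real.exp (z i) / ∑ k, Real.exp (z k)

/-- `A(z) = diag(softmax z) - softmax z (softmax z)ᵀ`. -/
noncomputable def Amat {c : ℕ} (z : Fin c → ℝ) : Matrix (Fin c) (Fin c) ℝ :=
  Matrix.diagonal (softmaxFn z) - Matrix.vecMulVec (softmaxFn z) (softmaxFn z)

/-- The diagonal ReLU-activation pattern matrix `D` of a pre-activation vector. -/
noncomputable def Dmat {n : ℕ} (u : Fin n → ℝ) : Matrix (Fin n) (Fin n) ℝ :=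
  Matrix.diagonal fun i => if 0 ≤ u i then (1 : ℝ) else 0

/-- The logits `z = W² σ(W¹ x)` of the two-layer ReLU network. -/
noncomputable def logits {c d n : ℕ}
    (w : ((Fin n × Fin d) → ℝ) × ((Fin c × Fin n) → ℝ)) (x : Fin d → ℝ) :
    Fin c → ℝ :=
  (W2of w.2).mulVec fun i => max ((W1of w.1).mulVec x i) 0

/-- The single-input output Hessian `D (W²)ᵀ A W² D` of the first layer. -/
noncomputable def hessOne {c d n : ℕ}
    (w : ((Fin n × Fin d) → ℝ) × ((Fin c × Fin n) → ℝ)) (x : Fin d → ℝ) :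
    Matrix (Fin n) (Fin n) ℝ :=
  Dmat ((W1of w.1).mulVec x) * (W2of w.2)ᵀ * Amat (logits w x) * W2of w.2 *
    Dmat ((W1of w.1).mulVec x)

/-- The output Hessian `M = E_x[D (W²)ᵀ A W² D]` (entrywise expectation over the
Gaussian input `x ~ N(0, I_d)`). -/
noncomputable def outputHessian (c d n : ℕ)
    (w : ((Fin n × Fin d) → ℝ) × ((Fin c × Fin n) → ℝ)) :
    Matrix (Fin n) (Fin n) ℝ :=
  Matrix.of fun i j => ∫ x, hessOne w x i j ∂(inputMeasure d)

/-- Squared Frobenius norm. -/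
noncomputable def frob2 {n m : ℕ} (A : Matrix (Fin n) (Fin m) ℝ) : ℝ :=
  ∑ i, ∑ j, (A i j) ^ 2

/-- The single-input output Hessian as a function of the second-layer weights and the
pre-activations of the first layer. -/
noncomputable def hessAct {c n : ℕ} (W : Matrix (Fin c) (Fin n) ℝ) (u : Fin n → ℝ) :
    Matrix (Fin n) (Fin n) ℝ :=
  Dmat u * Wᵀ * Amat (W *ᵥ fun i => max (u i) 0) * W * Dmat u

/-- The output Hessian for i.i.d. standard Gaussian pre-activations. -/
noncomputable def limHess {c n : ℕ} (W : Matrix (Fin c) (Fin n) ℝ) : Matrix (Fin n) (Fin n) ℝ :=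
  Matrix.of fun i j => ∫ u, hessAct W u i j ∂(inputMeasure n)

/-- The ratio `‖W M Wᵀ‖_F² / ‖M‖_F²`. -/
noncomputable def projRatio {c n : ℕ} (W : Matrix (Fin c) (Fin n) ℝ)
    (M : Matrix (Fin n) (Fin n) ℝ) : ℝ :=
  frob2 (W * M * Wᵀ) / frob2 M

instance (n : ℕ) : IsProbabilityMeasure (inputMeasure n) := by
  unfold inputMeasure; infer_instance

lemma hessOne_eq_hessAct {c d n : ℕ}
    (w : ((Fin n × Fin d) → ℝ) × ((Fin c × Fin n) → ℝ)) (x : Fin d → ℝ) :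
    hessOne w x = hessAct (W2of w.2) (W1of w.1 *ᵥ x) := rfl

lemma frob2_nonneg {n m : ℕ} (A : Matrix (Fin n) (Fin m) ℝ) : 0 ≤ frob2 A :=
  Finset.sum_nonneg fun _ _ => Finset.sum_nonneg fun _ _ => sq_nonneg _

lemma frob2_eq_zero {n m : ℕ} {A : Matrix (Fin n) (Fin m) ℝ} : frob2 A = 0 ↔ A = 0 := by
  unfold frob2
  rw [Finset.sum_eq_zero_iff_of_nonneg (f := fun i => ∑ j, A i j ^ 2)
    (fun _ _ => Finset.sum_nonneg fun _ _ => sq_nonneg _)]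
  constructor
  · intro h
    ext i j
    have := h i (Finset.mem_univ _)
    rw [Finset.sum_eq_zero_iff_of_nonneg (fun _ _ => sq_nonneg _)] at this
    simpa using this j (Finset.mem_univ _)
  · rintro rfl
    simp

lemma continuous_frob2 {n m : ℕ} :
    Continuous (frob2 : Matrix (Fin n) (Fin m) ℝ → ℝ) := by
  unfold frob2
  fun_prop

lemma projRatio_nonneg {c n : ℕ} (W : Matrix (Fin c) (Fin n) ℝ)
    (M : Matrix (Fin n) (Fin n) ℝ) : 0 ≤ projRatio W M :=
  div_nonneg (frob2_nonneg _) (frob2_nonneg _)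

section Softmax

variable {c : ℕ}

lemma softmaxFn_pos (z : Fin c → ℝ) (i : Fin c) : 0 < softmaxFn z i := by
  have : Nonempty (Fin c) := ⟨i⟩
  unfold softmaxFn
  have : 0 < ∑ k, Real.exp (z k) :=
    Finset.sum_pos (fun _ _ => Real.exp_pos _) Finset.univ_nonempty
  positivity

lemma softmaxFn_sum (hc : 0 < c) (z : Fin c → ℝ) : ∑ i, softmaxFn z i = 1 := by
  have : Nonempty (Fin c) := ⟨⟨0, hc⟩⟩
  unfold softmaxFn
  have : 0 < ∑ k, Real.exp (z k) :=
    Finset.sum_pos (fun _ _ => Real.exp_pos _) Finset.univ_nonempty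
  rw [← Finset.sum_div, div_self this.ne']

lemma softmaxFn_le_one (z : Fin c → ℝ) (i : Fin c) : softmaxFn z i ≤ 1 := by
  rw [← softmaxFn_sum i.pos z]
  exact Finset.single_le_sum (f := softmaxFn z) (fun k _ => (softmaxFn_pos z k).le)
    (Finset.mem_univ i)

lemma continuous_softmaxFn : Continuous (softmaxFn : (Fin c → ℝ) → Fin c → ℝ) := by
  refine continuous_pi fun i => ?_
  have : Nonempty (Fin c) := ⟨i⟩
  unfold softmaxFn
  refine Continuous.div (by fun_prop) (by fun_prop) fun z => ?_
  exact (Finset.sum_pos (fun _ _ => Real.exp_pos _) Finset.univ_nonempty).ne'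

lemma Amat_apply (z : Fin c → ℝ) (k l : Fin c) :
    Amat z k l = (if k = l then softmaxFn z k else 0) - softmaxFn z k * softmaxFn z l := by
  simp [Amat, Matrix.diagonal_apply, Matrix.vecMulVec_apply]

lemma continuous_Amat : Continuous (Amat : (Fin c → ℝ) → Matrix (Fin c) (Fin c) ℝ) := by
  have := continuous_softmaxFn (c := c)
  unfold Amat
  fun_prop

lemma abs_Amat_le_one (z : Fin c → ℝ) (k l : Fin c) : |Amat z k l| ≤ 1 := by
  have h1 := softmaxFn_pos z k
  have h2 := softmaxFn_le_one z k
  have h3 := softmaxFn_pos z l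
  have h4 := softmaxFn_le_one z l
  rw [Amat_apply, abs_le]
  split_ifs <;> constructor <;> nlinarith

lemma softmaxFn_sub_le (z z' : Fin c → ℝ) (i : Fin c) :
    softmaxFn z i - softmaxFn z' i ≤ 2 * ∑ m, |z m - z' m| := by
  obtain ⟨δ, hδ⟩ : ∃ δ, δ = ∑ m, |z m - z' m| := ⟨_, rfl⟩
  rw [← hδ]
  have hle : ∀ m, |z m - z' m| ≤ δ := fun m => hδ ▸
    Finset.single_le_sum (f := fun m => |z m - z' m|) (fun k _ => abs_nonneg (z k - z' k))
      (Finset.mem_univ m)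
  have : Nonempty (Fin c) := ⟨i⟩
  have hS : 0 < ∑ k, Real.exp (z k) :=
    Finset.sum_pos (fun _ _ => Real.exp_pos _) Finset.univ_nonempty
  have hS' : 0 < ∑ k, Real.exp (z' k) :=
    Finset.sum_pos (fun _ _ => Real.exp_pos _) Finset.univ_nonempty
  have h1 : Real.exp (-(2 * δ)) * softmaxFn z i ≤ softmaxFn z' i := by
    unfold softmaxFn
    rw [← mul_div_assoc, div_le_div_iff₀ hS hS', Finset.mul_sum, Finset.mul_sum]
    refine Finset.sum_le_sum fun k _ => ?_
    rw [← Real.exp_add, ← Real.exp_add, ← Real.exp_add]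
    apply Real.exp_le_exp.2
    have := abs_le.1 (hle i)
    have := abs_le.1 (hle k)
    linarith
  have h2 : 1 - 2 * δ ≤ Real.exp (-(2 * δ)) := by
    have := Real.add_one_le_exp (-(2 * δ))
    linarith
  have h3 := softmaxFn_pos z i
  have h4 := softmaxFn_le_one z i
  have h5 : 0 ≤ δ := (abs_nonneg _).trans (hle i)
  nlinarith

lemma abs_softmaxFn_sub_le (z z' : Fin c → ℝ) (i : Fin c) :
    |softmaxFn z i - softmaxFn z' i| ≤ 2 * ∑ m, |z m - z' m| := by
  rw [abs_le]
  have h1 := softmaxFn_sub_le z z' i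
  have h2 := softmaxFn_sub_le z' z i
  simp only [abs_sub_comm (z' _)] at h2
  constructor <;> linarith

lemma abs_Amat_sub_le (z z' : Fin c → ℝ) (k l : Fin c) :
    |Amat z k l - Amat z' k l| ≤ 6 * ∑ m, |z m - z' m| := by
  have hk := abs_softmaxFn_sub_le z z' k
  have hl := abs_softmaxFn_sub_le z z' l
  have h1 := softmaxFn_pos z k
  have h2 := softmaxFn_le_one z k
  have h3 := softmaxFn_pos z' l
  have h4 := softmaxFn_le_one z' l
  have h5 : |softmaxFn z k * softmaxFn z l - softmaxFn z' k * softmaxFn z' l| ≤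
      |softmaxFn z l - softmaxFn z' l| + |softmaxFn z k - softmaxFn z' k| := by
    have : softmaxFn z k * softmaxFn z l - softmaxFn z' k * softmaxFn z' l =
        softmaxFn z k * (softmaxFn z l - softmaxFn z' l) +
          (softmaxFn z k - softmaxFn z' k) * softmaxFn z' l := by ring
    rw [this]
    refine (abs_add_le _ _).trans ?_
    rw [abs_mul, abs_mul, abs_of_pos h1, abs_of_pos h3]
    have := abs_nonneg (softmaxFn z l - softmaxFn z' l)
    have := abs_nonneg (softmaxFn z k - softmaxFn z' k)
    nlinarith
  replace h5 := abs_le.1 (h5.trans (add_le_add hl hk))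
  rw [abs_le] at hk
  have h6 : 0 ≤ ∑ m, |z m - z' m| := Finset.sum_nonneg fun _ _ => abs_nonneg _
  rw [Amat_apply, Amat_apply, abs_le]
  split_ifs <;> constructor <;> linarith

lemma Amat_quadForm_ge (z v : Fin c → ℝ) {a b : Fin c} (hab : a ≠ b) :
    softmaxFn z a * softmaxFn z b * (v a - v b) ^ 2 ≤ ∑ k, ∑ l, v k * Amat z k l * v l := by
  set p := softmaxFn z with hp
  have hsum : ∑ k, p k = 1 := softmaxFn_sum a.pos z
  have hpos : ∀ k, 0 < p k := softmaxFn_pos z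
  have h1 : ∑ k, ∑ l, v k * Amat z k l * v l = (∑ k, p k * v k ^ 2) - (∑ k, p k * v k) ^ 2 := by
    simp only [Amat_apply, mul_sub, sub_mul, Finset.sum_sub_distrib]
    congr 1
    · refine Finset.sum_congr rfl fun k _ => ?_
      simp [mul_ite, ite_mul]
      ring
    · rw [sq, Finset.sum_mul_sum]
      refine Finset.sum_congr rfl fun k _ => Finset.sum_congr rfl fun l _ => ?_
      ring
  have h2 : (∑ k, p k * v k ^ 2) - (∑ k, p k * v k) ^ 2 =
      (∑ k, ∑ l, p k * p l * (v k - v l) ^ 2) / 2 := by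
    have e1 : ∑ k, ∑ l, p k * p l * (v k - v l) ^ 2 =
        ∑ k, ∑ l, ((p k * v k ^ 2) * p l + p k * (p l * v l ^ 2)
          - 2 * ((p k * v k) * (p l * v l))) :=
      Finset.sum_congr rfl fun k _ => Finset.sum_congr rfl fun l _ => by ring
    rw [e1]
    simp only [Finset.sum_sub_distrib, Finset.sum_add_distrib, ← Finset.mul_sum,
      ← Finset.sum_mul, hsum]
    ring
  rw [h1, h2]
  have hnn : ∀ k l, 0 ≤ p k * p l * (v k - v l) ^ 2 := fun k l =>
    mul_nonneg (mul_nonneg (hpos k).le (hpos l).le) (sq_nonneg _)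
  have h3 : p a * p b * (v a - v b) ^ 2 + p b * p a * (v b - v a) ^ 2 ≤
      ∑ k, ∑ l, p k * p l * (v k - v l) ^ 2 := by
    rw [← Finset.sum_product']
    have := Finset.sum_le_sum_of_subset_of_nonneg
      (f := fun x : Fin c × Fin c => p x.1 * p x.2 * (v x.1 - v x.2) ^ 2)
      (Finset.subset_univ {(a, b), (b, a)}) (fun x _ _ => hnn x.1 x.2)
    rw [Finset.sum_pair (by simp [hab])] at this
    simpa using this
  nlinarith [h3]

lemma Amat_diag_ge (z : Fin c → ℝ) {a b : Fin c} (hab : a ≠ b) :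
    softmaxFn z a * softmaxFn z b ≤ Amat z a a := by
  have h1 := softmaxFn_pos z a
  have h2 : softmaxFn z a + softmaxFn z b ≤ 1 := by
    rw [← softmaxFn_sum a.pos z, ← Finset.sum_pair hab]
    exact Finset.sum_le_sum_of_subset_of_nonneg (Finset.subset_univ _)
      fun k _ _ => (softmaxFn_pos z k).le
  rw [Amat_apply, if_pos rfl]
  nlinarith

end Softmax

section HessAct

variable {c n : ℕ}

lemma hessAct_apply (W : Matrix (Fin c) (Fin n) ℝ) (u : Fin n → ℝ) (i j : Fin n) :
    hessAct W u i j = (if 0 ≤ u i then (1 : ℝ) else 0) * (if 0 ≤ u j then (1 : ℝ) else 0) *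
      ∑ k, ∑ l, W k i * Amat (W *ᵥ fun i => max (u i) 0) k l * W l j := by
  unfold hessAct Dmat
  rw [Matrix.mul_diagonal, Matrix.mul_assoc, Matrix.mul_assoc, Matrix.diagonal_mul,
    ← Matrix.mul_assoc, Matrix.mul_apply]
  simp only [Matrix.mul_apply, Matrix.transpose_apply, Finset.sum_mul]
  rw [Finset.sum_comm]
  ring

lemma abs_sum_mul_le {f : Fin c → Fin c → ℝ} {B : ℝ} (hf : ∀ k l, |f k l| ≤ B)
    (W : Matrix (Fin c) (Fin n) ℝ) (i j : Fin n) :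
    |∑ k, ∑ l, W k i * f k l * W l j| ≤ B * ((∑ k, |W k i|) * ∑ l, |W l j|) := by
  rw [Finset.sum_mul_sum, Finset.mul_sum]
  refine (Finset.abs_sum_le_sum_abs _ _).trans (Finset.sum_le_sum fun k _ => ?_)
  rw [Finset.mul_sum]
  refine (Finset.abs_sum_le_sum_abs _ _).trans (Finset.sum_le_sum fun l _ => ?_)
  rw [abs_mul, abs_mul]
  have := mul_le_mul_of_nonneg_left (hf k l) (mul_nonneg (abs_nonneg (W k i)) (abs_nonneg (W l j)))
  linarith

lemma abs_hessAct_le (W : Matrix (Fin c) (Fin n) ℝ) (u : Fin n → ℝ) (i j : Fin n) :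
    |hessAct W u i j| ≤ (∑ k, |W k i|) * ∑ l, |W l j| := by
  have h := abs_sum_mul_le (abs_Amat_le_one (W *ᵥ fun i => max (u i) 0)) W i j
  rw [one_mul] at h
  rw [hessAct_apply, abs_mul]
  refine le_trans ?_ h
  refine mul_le_of_le_one_left (abs_nonneg _) ?_
  split_ifs <;> simp

lemma continuous_W2of : Continuous (W2of : ((Fin c × Fin n) → ℝ) → _) := by
  unfold W2of
  fun_prop

lemma measurable_hessAct_uncurry (i j : Fin n) :
    Measurable fun q : ((Fin c × Fin n) → ℝ) × (Fin n → ℝ) => hessAct (W2of q.1) q.2 i j := by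
  have hA : ∀ k l, Measurable fun q : ((Fin c × Fin n) → ℝ) × (Fin n → ℝ) =>
      Amat (W2of q.1 *ᵥ fun i => max (q.2 i) 0) k l := by
    intro k l
    have hW := continuous_W2of (c := c) (n := n)
    have : Continuous fun q : ((Fin c × Fin n) → ℝ) × (Fin n → ℝ) =>
        Amat (W2of q.1 *ᵥ fun i => max (q.2 i) 0) k l := by
      have h := (continuous_Amat (c := c)).comp (f := fun q : ((Fin c × Fin n) → ℝ) ×
        (Fin n → ℝ) => W2of q.1 *ᵥ fun i => max (q.2 i) 0) (by fun_prop)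
      exact (continuous_apply l).comp ((continuous_apply k).comp h)
    exact this.measurable
  have hD : ∀ i, Measurable fun q : ((Fin c × Fin n) → ℝ) × (Fin n → ℝ) =>
      (if 0 ≤ q.2 i then (1 : ℝ) else 0) := fun i =>
    Measurable.ite (measurableSet_le measurable_const (by fun_prop)) measurable_const
      measurable_const
  have hW : ∀ k i, Measurable fun q : ((Fin c × Fin n) → ℝ) × (Fin n → ℝ) => W2of q.1 k i :=
    fun k i => (measurable_pi_apply (k, i)).comp measurable_fst
  simp only [hessAct_apply]
  refine ((hD i).mul (hD j)).mul ?_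
  refine Finset.measurable_sum _ fun k _ => Finset.measurable_sum _ fun l _ => ?_
  exact ((hW k i).mul (hA k l)).mul (hW l j)

lemma W2of_surjective : Function.Surjective (W2of : ((Fin c × Fin n) → ℝ) → _) :=
  fun W => ⟨fun p => W p.1 p.2, rfl⟩

lemma measurable_hessAct (W : Matrix (Fin c) (Fin n) ℝ) (i j : Fin n) :
    Measurable fun u => hessAct W u i j := by
  obtain ⟨w, rfl⟩ := W2of_surjective W
  have h := (measurable_hessAct_uncurry (c := c) i j).comp
    (measurable_prodMk_left (x := w) (β := Fin n → ℝ))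
  exact h

lemma integrable_hessAct (W : Matrix (Fin c) (Fin n) ℝ) (i j : Fin n)
    (μ : Measure (Fin n → ℝ)) [IsFiniteMeasure μ] :
    Integrable (fun u => hessAct W u i j) μ :=
  Integrable.of_bound (measurable_hessAct W i j).aestronglyMeasurable
    ((∑ k, |W k i|) * ∑ l, |W l j|) (ae_of_all _ fun u => abs_hessAct_le W u i j)

end HessAct

section GaussianLaw

lemma charFun_map_mulVec {m n : ℕ} (A : Matrix (Fin m) (Fin n) ℝ)
    (t : EuclideanSpace ℝ (Fin m)) :
    charFun ((inputMeasure n).map fun u => WithLp.toLp 2 (A *ᵥ u)) t =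
      Complex.exp (-((t.ofLp ⬝ᵥ (A * Aᵀ) *ᵥ t.ofLp : ℝ) : ℂ) / 2) := by
  have h1 : charFun ((inputMeasure n).map fun u => WithLp.toLp 2 (A *ᵥ u)) t =
      charFun ((inputMeasure n).map (WithLp.toLp 2)) (WithLp.toLp 2 (Aᵀ *ᵥ t.ofLp)) := by
    have hm : Measurable fun u : Fin n → ℝ => WithLp.toLp 2 (A *ᵥ u) := by
      have : Continuous fun u : Fin n → ℝ => WithLp.toLp 2 (A *ᵥ u) := by fun_prop
      exact this.measurable
    rw [charFun_apply, charFun_apply, integral_map hm.aemeasurable (by fun_prop),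
      integral_map (by fun_prop) (by fun_prop)]
    congr with u
    simp only [EuclideanSpace.inner_eq_star_dotProduct, star_trivial]
    rw [Matrix.mulVec_transpose, Matrix.dotProduct_mulVec, dotProduct_comm]
  rw [h1, inputMeasure, map_pi_eq_stdGaussian, charFun_stdGaussian]
  congr 2
  rw [EuclideanSpace.norm_eq, ← Complex.ofReal_pow, Real.sq_sqrt (by positivity)]
  norm_cast
  congr 1
  simp only [Real.norm_eq_abs, sq_abs]
  rw [← Matrix.mulVec_mulVec, Matrix.dotProduct_mulVec, ← Matrix.mulVec_transpose]
  simp [dotProduct, sq]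

lemma map_mulVec_eq_of_mul_transpose_eq {m n n' : ℕ} (A : Matrix (Fin m) (Fin n) ℝ)
    (B : Matrix (Fin m) (Fin n') ℝ) (h : A * Aᵀ = B * Bᵀ) :
    (inputMeasure n).map (fun u => A *ᵥ u) = (inputMeasure n').map (fun u => B *ᵥ u) := by
  have hm : ∀ {k : ℕ} (C : Matrix (Fin m) (Fin k) ℝ),
      Measurable fun u : Fin k → ℝ => WithLp.toLp 2 (C *ᵥ u) := by
    intro k C
    have : Continuous fun u : Fin k → ℝ => WithLp.toLp 2 (C *ᵥ u) := by fun_prop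
    exact this.measurable
  have h1 : (inputMeasure n).map (fun u => WithLp.toLp 2 (A *ᵥ u)) =
      (inputMeasure n').map (fun u => WithLp.toLp 2 (B *ᵥ u)) := by
    have := Measure.isProbabilityMeasure_map (μ := inputMeasure n) (hm A).aemeasurable
    have := Measure.isProbabilityMeasure_map (μ := inputMeasure n') (hm B).aemeasurable
    refine Measure.ext_of_charFun ?_
    ext t
    rw [charFun_map_mulVec, charFun_map_mulVec, h]
  have h2 := congrArg (Measure.map (WithLp.ofLp : EuclideanSpace ℝ (Fin m) → Fin m → ℝ)) h1
  rw [Measure.map_map (by fun_prop) (hm A), Measure.map_map (by fun_prop) (hm B)] at h2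
  exact h2

open scoped Matrix.Norms.L2Operator MatrixOrder in
lemma map_mulVec_eq_map_sqrt {d n : ℕ} (A : Matrix (Fin n) (Fin d) ℝ) :
    (inputMeasure d).map (fun u => A *ᵥ u) =
      (inputMeasure n).map (fun u => CFC.sqrt (A * Aᵀ) *ᵥ u) := by
  have hpos : 0 ≤ A * Aᵀ := by
    rw [Matrix.nonneg_iff_posSemidef]
    simpa using Matrix.posSemidef_self_mul_conjTranspose A
  apply map_mulVec_eq_of_mul_transpose_eq
  have hs : (CFC.sqrt (A * Aᵀ))ᵀ = CFC.sqrt (A * Aᵀ) := by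
    have := (Matrix.nonneg_iff_posSemidef.1 (CFC.sqrt_nonneg (A * Aᵀ))).isHermitian
    simpa [Matrix.IsHermitian] using this
  rw [hs, CFC.sqrt_mul_sqrt_self _ hpos]

open scoped Matrix.Norms.L2Operator MatrixOrder in
lemma tendsto_sqrt_one {n : ℕ} :
    Tendsto (fun G : Matrix (Fin n) (Fin n) ℝ => CFC.sqrt G)
      (nhdsWithin 1 {G | G.PosSemidef}) (nhds 1) := by
  have h := (CFC.continuousOn_sqrt (A := Matrix (Fin n) (Fin n) ℝ)) 1
    (by simp)
  have h2 : CFC.sqrt (1 : Matrix (Fin n) (Fin n) ℝ) = 1 := by simp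
  have h3 : {G : Matrix (Fin n) (Fin n) ℝ | 0 ≤ G} = {G | G.PosSemidef} := by
    ext G; simp [Matrix.nonneg_iff_posSemidef]
  rw [ContinuousWithinAt, h2, h3] at h
  exact h

end GaussianLaw

section Continuity

lemma ae_inputMeasure_ne_zero (n : ℕ) : ∀ᵐ u ∂(inputMeasure n), ∀ i, u i ≠ 0 := by
  rw [ae_all_iff]
  intro i
  have h := (measurePreserving_eval (fun _ : Fin n => gaussianReal 0 1) i).quasiMeasurePreserving
  have : NullSingletonClass (gaussianReal 0 1) := nullSingletonClass_gaussianReal (by simp)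
  have h0 : ∀ᵐ x ∂(gaussianReal 0 1), x ≠ 0 := by
    rw [ae_iff]; simp [measure_singleton]
  exact h.ae h0

variable {c n : ℕ}

lemma continuousAt_hessAct (W : Matrix (Fin c) (Fin n) ℝ) {u : Fin n → ℝ} (hu : ∀ i, u i ≠ 0)
    (i j : Fin n) : ContinuousAt (fun u => hessAct W u i j) u := by
  have hD : ∀ i, ContinuousAt (fun u : Fin n → ℝ => if 0 ≤ u i then (1 : ℝ) else 0) u := by
    intro i
    rcases lt_or_gt_of_ne (hu i) with h | h
    · have : ∀ᶠ v in nhds u, (if 0 ≤ v i then (1 : ℝ) else 0) = 0 := by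
        have : ∀ᶠ v : Fin n → ℝ in nhds u, v i < 0 :=
          (continuous_apply i).continuousAt.eventually_lt continuousAt_const h
        filter_upwards [this] with v hv
        simp [hv]
      exact (continuousAt_const (y := (0 : ℝ))).congr
        (this.mono fun v hv => hv.symm)
    · have : ∀ᶠ v in nhds u, (if 0 ≤ v i then (1 : ℝ) else 0) = 1 := by
        have : ∀ᶠ v : Fin n → ℝ in nhds u, 0 < v i :=
          continuousAt_const.eventually_lt (continuous_apply i).continuousAt h
        filter_upwards [this] with v hv
        simp [hv.le]
      exact (continuousAt_const (y := (1 : ℝ))).congr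
        (this.mono fun v hv => hv.symm)
  simp only [hessAct_apply]
  refine ((hD i).mul (hD j)).mul (Continuous.continuousAt ?_)
  refine continuous_finsetSum _ fun k _ => continuous_finsetSum _ fun l _ => ?_
  have h := (continuous_Amat (c := c)).comp (f := fun u : Fin n → ℝ =>
    W *ᵥ fun i => max (u i) 0) (by fun_prop)
  have h2 : Continuous fun u : Fin n → ℝ => Amat (W *ᵥ fun i => max (u i) 0) k l :=
    (continuous_apply l).comp ((continuous_apply k).comp h)
  fun_prop

lemma tendsto_integral_hessAct_mulVec (W : Matrix (Fin c) (Fin n) ℝ) (i j : Fin n) :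
    Tendsto (fun S : Matrix (Fin n) (Fin n) ℝ =>
        ∫ u, hessAct W (S *ᵥ u) i j ∂(inputMeasure n))
      (nhds 1) (nhds (limHess W i j)) := by
  have : FirstCountableTopology (Matrix (Fin n) (Fin n) ℝ) :=
    inferInstanceAs (FirstCountableTopology (Fin n → Fin n → ℝ))
  refine tendsto_integral_filter_of_dominated_convergence
    (fun _ => (∑ k, |W k i|) * ∑ l, |W l j|) ?_ ?_ (integrable_const _) ?_
  · refine Eventually.of_forall fun S => Measurable.aestronglyMeasurable ?_
    have h : Measurable fun u : Fin n → ℝ => S *ᵥ u :=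
      (show Continuous fun u : Fin n → ℝ => S *ᵥ u by fun_prop).measurable
    exact (measurable_hessAct W i j).comp h
  · exact Eventually.of_forall fun S => ae_of_all _ fun u => abs_hessAct_le W _ i j
  · filter_upwards [ae_inputMeasure_ne_zero n] with u hu
    have h1 : Tendsto (fun S : Matrix (Fin n) (Fin n) ℝ => S *ᵥ u) (nhds 1) (nhds u) := by
      have : Continuous fun S : Matrix (Fin n) (Fin n) ℝ => S *ᵥ u := by fun_prop
      simpa using this.tendsto 1
    exact (continuousAt_hessAct W hu i j).tendsto.comp h1

open scoped Matrix.Norms.L2Operator MatrixOrder in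
/-- The output Hessian converges to its value at i.i.d. standard Gaussian pre-activations as the
Gram matrix of the first-layer weights tends to the identity. -/
lemma exists_tendsto_outputHessian (W : Matrix (Fin c) (Fin n) ℝ) :
    ∃ F : Matrix (Fin n) (Fin n) ℝ → Matrix (Fin n) (Fin n) ℝ,
      Tendsto F (nhdsWithin 1 {G | G.PosSemidef}) (nhds (limHess W)) ∧
      ∀ (d : ℕ) (w : ((Fin n × Fin d) → ℝ) × ((Fin c × Fin n) → ℝ)), W2of w.2 = W →
        outputHessian c d n w = F (W1of w.1 * (W1of w.1)ᵀ) := by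
  refine ⟨fun G => Matrix.of fun i j =>
    ∫ u, hessAct W (CFC.sqrt G *ᵥ u) i j ∂(inputMeasure n), ?_, ?_⟩
  · refine tendsto_pi_nhds.2 fun i => tendsto_pi_nhds.2 fun j => ?_
    exact (tendsto_integral_hessAct_mulVec W i j).comp tendsto_sqrt_one
  · rintro d w rfl
    ext i j
    simp only [outputHessian, Matrix.of_apply, hessOne_eq_hessAct]
    have hm : ∀ {k : ℕ} (C : Matrix (Fin n) (Fin k) ℝ), Measurable fun u : Fin k → ℝ => C *ᵥ u :=
      fun C => (show Continuous fun u => C *ᵥ u by fun_prop).measurable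
    have h1 := integral_map (μ := inputMeasure d) (hm (W1of w.1)).aemeasurable
      (measurable_hessAct (W2of w.2) i j).aestronglyMeasurable
    have h2 := integral_map (μ := inputMeasure n)
      (hm (CFC.sqrt (W1of w.1 * (W1of w.1)ᵀ))).aemeasurable
      (measurable_hessAct (W2of w.2) i j).aestronglyMeasurable
    rw [← h1, ← h2, map_mulVec_eq_map_sqrt]

end Continuity

/-- The law of an `m × N` matrix with i.i.d. `N(0, 1/N)` entries. -/
noncomputable def scaledGaussian (m N : ℕ) : Measure ((Fin m × Fin N) → ℝ) :=
  Measure.pi fun _ => gaussianReal 0 (N : ℝ≥0)⁻¹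

instance (m N : ℕ) : IsProbabilityMeasure (scaledGaussian m N) := by
  unfold scaledGaussian; infer_instance

section Moments

lemma integrable_pow_gaussianReal (v : ℝ≥0) (k : ℕ) :
    Integrable (fun x => x ^ k) (gaussianReal 0 v) := by
  have h := (memLp_id_gaussianReal (μ := 0) (v := v) (k : ℝ≥0)).integrable_norm_pow'
  refine (integrable_norm_iff (by fun_prop)).1 ?_
  simpa using h

/-- The fourth moment of the standard Gaussian. -/
noncomputable def gaussMomentFour : ℝ := ∫ x, x ^ 4 ∂(gaussianReal 0 1)

lemma integral_pow_four_gaussianReal_inv (N : ℕ) :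
    ∫ x, x ^ 4 ∂(gaussianReal 0 (N : ℝ≥0)⁻¹) = gaussMomentFour / (N : ℝ) ^ 2 := by
  have h := gaussianReal_map_const_mul (μ := 0) (v := 1) (√(N : ℝ))⁻¹
  have h2 : NNReal.mk ((√(N : ℝ))⁻¹ ^ 2) (sq_nonneg _) * 1 = (N : ℝ≥0)⁻¹ := by
    ext
    simp [inv_pow]
  rw [h2, mul_zero] at h
  rw [← h, integral_map (by fun_prop) (by fun_prop), gaussMomentFour]
  simp only [mul_pow]
  rw [integral_const_mul]
  have h3 : (√(N : ℝ))⁻¹ ^ 4 = ((N : ℝ) ^ 2)⁻¹ := by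
    rw [inv_pow, show (4 : ℕ) = 2 * 2 from rfl, pow_mul, Real.sq_sqrt (by positivity)]
  rw [h3]
  ring

variable {m N : ℕ}

lemma measurePreserving_scaledGaussian_eval (p : Fin m × Fin N) :
    MeasurePreserving (fun w => w p) (scaledGaussian m N) (gaussianReal 0 (N : ℝ≥0)⁻¹) :=
  measurePreserving_eval (fun _ : Fin m × Fin N => gaussianReal 0 (N : ℝ≥0)⁻¹) p

lemma integral_scaledGaussian_eval (p : Fin m × Fin N) {f : ℝ → ℝ} (hf : Measurable f) :
    ∫ w, f (w p) ∂(scaledGaussian m N) = ∫ x, f x ∂(gaussianReal 0 (N : ℝ≥0)⁻¹) := by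
  rw [← (measurePreserving_scaledGaussian_eval p).map_eq,
    integral_map (measurable_pi_apply p).aemeasurable hf.aestronglyMeasurable]

lemma memLp_scaledGaussian_eval (p : Fin m × Fin N) (k : ℝ≥0) :
    MemLp (fun w => w p) k (scaledGaussian m N) :=
  (memLp_id_gaussianReal (μ := 0) (v := (N : ℝ≥0)⁻¹) k).comp_measurePreserving
    (measurePreserving_scaledGaussian_eval p)

lemma integrable_scaledGaussian_pow (p : Fin m × Fin N) (k : ℕ) :
    Integrable (fun w => w p ^ k) (scaledGaussian m N) :=
  (measurePreserving_scaledGaussian_eval p).integrable_comp_of_integrable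
    (integrable_pow_gaussianReal _ k)

lemma integral_scaledGaussian_sq (p : Fin m × Fin N) :
    ∫ w, w p ^ 2 ∂(scaledGaussian m N) = (N : ℝ)⁻¹ := by
  rw [integral_scaledGaussian_eval p (f := fun x => x ^ 2) (by fun_prop)]
  have h := variance_fun_id_gaussianReal (μ := 0) (v := (N : ℝ≥0)⁻¹)
  rw [variance_eq_integral (by fun_prop)] at h
  simpa using h

lemma integral_scaledGaussian_pow_four (p : Fin m × Fin N) :
    ∫ w, w p ^ 4 ∂(scaledGaussian m N) = gaussMomentFour / (N : ℝ) ^ 2 := by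
  rw [integral_scaledGaussian_eval p (f := fun x => x ^ 4) (by fun_prop),
    integral_pow_four_gaussianReal_inv]

lemma integral_scaledGaussian_id (p : Fin m × Fin N) :
    ∫ w, w p ∂(scaledGaussian m N) = 0 := by
  rw [integral_scaledGaussian_eval p (f := fun x => x) (by fun_prop)]
  exact integral_id_gaussianReal

lemma iIndepFun_scaledGaussian :
    iIndepFun (fun (p : Fin m × Fin N) w => w p) (scaledGaussian m N) :=
  iIndepFun_pi (X := fun _ => id) fun _ => aemeasurable_id

lemma integral_scaledGaussian_mul (p q : Fin m × Fin N) :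
    ∫ w, w p * w q ∂(scaledGaussian m N) = if p = q then (N : ℝ)⁻¹ else 0 := by
  split_ifs with h
  · subst h
    rw [← integral_scaledGaussian_sq p]
    simp only [sq]
  · have := (iIndepFun_scaledGaussian.indepFun h).integral_fun_mul_eq_mul_integral
      (measurable_pi_apply p).aestronglyMeasurable (measurable_pi_apply q).aestronglyMeasurable
    rw [this, integral_scaledGaussian_id, zero_mul]

lemma memLp_scaledGaussian_mul (p q : Fin m × Fin N) :
    MemLp (fun w => w p * w q) 2 (scaledGaussian m N) := by
  have : ENNReal.HolderTriple ((4 : ℝ≥0) : ℝ≥0∞) ((4 : ℝ≥0) : ℝ≥0∞) 2 := ⟨by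
    rw [← ENNReal.toReal_eq_toReal_iff' (by simp) (by simp),
      ENNReal.toReal_add (by simp) (by simp)]
    norm_num⟩
  have h := (memLp_scaledGaussian_eval q 4).mul (memLp_scaledGaussian_eval p 4) (r := 2)
  exact h

lemma variance_scaledGaussian_mul_le (p q : Fin m × Fin N) :
    variance (fun w => w p * w q) (scaledGaussian m N) ≤ gaussMomentFour / (N : ℝ) ^ 2 := by
  refine (variance_le_expectation_sq (by fun_prop)).trans ?_
  have h : ∀ w : Fin m × Fin N → ℝ, (w p * w q) ^ 2 ≤ (w p ^ 4 + w q ^ 4) / 2 := fun w => by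
    nlinarith [sq_nonneg (w p ^ 2 - w q ^ 2)]
  have hi : Integrable (fun w : Fin m × Fin N → ℝ => (w p ^ 4 + w q ^ 4) / 2)
      (scaledGaussian m N) :=
    ((integrable_scaledGaussian_pow p 4).add (integrable_scaledGaussian_pow q 4)).div_const 2
  refine (integral_mono (memLp_scaledGaussian_mul p q).integrable_sq hi h).trans ?_
  rw [integral_div, integral_add (integrable_scaledGaussian_pow p 4)
    (integrable_scaledGaussian_pow q 4), integral_scaledGaussian_pow_four,
    integral_scaledGaussian_pow_four]
  linarith

lemma W1of_mul_transpose_apply (w : (Fin m × Fin N) → ℝ) (k l : Fin m) :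
    (W1of w * (W1of w)ᵀ) k l = ∑ j, w (k, j) * w (l, j) := by
  simp [Matrix.mul_apply, W1of]

lemma variance_gram_le (k l : Fin m) :
    variance (fun w => (W1of w * (W1of w)ᵀ) k l) (scaledGaussian m N) ≤ gaussMomentFour / N := by
  simp only [W1of_mul_transpose_apply]
  have h := IndepFun.variance_sum (μ := scaledGaussian m N) (s := Finset.univ)
    (X := fun (j : Fin N) (w : (Fin m × Fin N) → ℝ) => w (k, j) * w (l, j))
    (fun j _ => memLp_scaledGaussian_mul _ _) (by
      intro i _ j _ hij
      have := iIndepFun_scaledGaussian (m := m) (N := N).indepFun_prodMk_prodMk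
        (fun _ => by fun_prop) (k, i) (l, i) (k, j) (l, j)
        (by simp [hij]) (by simp [hij]) (by simp [hij]) (by simp [hij])
      exact this.comp (φ := fun x : ℝ × ℝ => x.1 * x.2) (ψ := fun x : ℝ × ℝ => x.1 * x.2)
        (by fun_prop) (by fun_prop))
  have h2 : (∑ j, fun w : (Fin m × Fin N) → ℝ => w (k, j) * w (l, j)) =
      fun w => ∑ j, w (k, j) * w (l, j) := by
    ext w; simp
  rw [h2] at h
  rw [h]
  refine (Finset.sum_le_sum fun j _ => variance_scaledGaussian_mul_le _ _).trans ?_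
  rw [Finset.sum_const, Finset.card_univ, Fintype.card_fin, nsmul_eq_mul]
  rcases Nat.eq_zero_or_pos N with rfl | hN
  · simp
  · have : (0 : ℝ) < N := by exact_mod_cast hN
    apply le_of_eq
    field_simp

lemma integral_gram (hN : 0 < N) (k l : Fin m) :
    ∫ w, (W1of w * (W1of w)ᵀ) k l ∂(scaledGaussian m N) =
      (1 : Matrix (Fin m) (Fin m) ℝ) k l := by
  simp only [W1of_mul_transpose_apply]
  rw [integral_finsetSum _ fun j _ => (memLp_scaledGaussian_mul _ _).integrable (by simp)]
  simp only [integral_scaledGaussian_mul, Prod.mk.injEq, and_true, Matrix.one_apply]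
  have : (0 : ℝ) < N := by exact_mod_cast hN
  split_ifs
  · simp [this.ne']
  · simp

/-- The Gram matrix of the rows of an `m × N` matrix with i.i.d. `N(0, 1/N)` entries tends to the
identity in probability as `N → ∞`. -/
lemma tendsto_measure_gram (m : ℕ) {η : ℝ} (hη : 0 < η) :
    Tendsto (fun N => scaledGaussian m N {w | ∃ k l,
      η ≤ |(W1of w * (W1of w)ᵀ) k l - (1 : Matrix (Fin m) (Fin m) ℝ) k l|}) atTop (nhds 0) := by
  have hb : ∀ᶠ N : ℕ in atTop, scaledGaussian m N {w | ∃ k l,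
      η ≤ |(W1of w * (W1of w)ᵀ) k l - (1 : Matrix (Fin m) (Fin m) ℝ) k l|} ≤
      ∑ _k : Fin m, ∑ _l : Fin m, ENNReal.ofReal (gaussMomentFour / N / η ^ 2) := by
    filter_upwards [eventually_gt_atTop 0] with N hN
    have : {w : (Fin m × Fin N) → ℝ | ∃ k l,
        η ≤ |(W1of w * (W1of w)ᵀ) k l - (1 : Matrix (Fin m) (Fin m) ℝ) k l|} =
        ⋃ k, ⋃ l, {w | η ≤ |(W1of w * (W1of w)ᵀ) k l - (1 : Matrix (Fin m) (Fin m) ℝ) k l|} := by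
      ext w; simp
    rw [this]
    refine (measure_iUnion_fintype_le _ _).trans (Finset.sum_le_sum fun k _ => ?_)
    refine (measure_iUnion_fintype_le _ _).trans (Finset.sum_le_sum fun l _ => ?_)
    rw [← integral_gram hN k l]
    refine (meas_ge_le_variance_div_sq ?_ hη).trans (ENNReal.ofReal_le_ofReal ?_)
    · simp only [W1of_mul_transpose_apply]
      exact memLp_finsetSum _ fun j _ => memLp_scaledGaussian_mul _ _
    · gcongr
      exact variance_gram_le k l
  have hlim : Tendsto (fun N : ℕ => ∑ _k : Fin m, ∑ _l : Fin m,
      ENNReal.ofReal (gaussMomentFour / N / η ^ 2)) atTop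
      (nhds (∑ _k : Fin m, ∑ _l : Fin m, ENNReal.ofReal (0 / η ^ 2))) := by
    refine tendsto_finsetSum _ fun _ _ => tendsto_finsetSum _ fun _ _ => ?_
    refine ENNReal.tendsto_ofReal (Tendsto.div_const ?_ _)
    exact tendsto_const_div_atTop_nhds_zero_nat _
  simp only [zero_div, ENNReal.ofReal_zero, Finset.sum_const_zero] at hlim
  exact tendsto_of_tendsto_of_tendsto_of_le_of_le' tendsto_const_nhds hlim
    (Eventually.of_forall fun _ => zero_le) hb

/-- The sum of the fourth powers of the entries of an `m × N` matrix with i.i.d. `N(0, 1/N)`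
entries tends to zero in probability as `N → ∞`. -/
lemma tendsto_measure_sum_pow_four (m : ℕ) {η : ℝ} (hη : 0 < η) :
    Tendsto (fun N => scaledGaussian m N {w | η ≤ ∑ p, w p ^ 4}) atTop (nhds 0) := by
  have hb : ∀ᶠ N : ℕ in atTop, scaledGaussian m N {w | η ≤ ∑ p, w p ^ 4} ≤
      ENNReal.ofReal (m * gaussMomentFour / N / η) := by
    filter_upwards [eventually_gt_atTop 0] with N hN
    have hint : Integrable (fun w : (Fin m × Fin N) → ℝ => ∑ p, w p ^ 4) (scaledGaussian m N) :=
      integrable_finsetSum _ fun p _ => integrable_scaledGaussian_pow p 4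
    have h := mul_meas_ge_le_integral_of_nonneg
      (ae_of_all _ fun w => Finset.sum_nonneg fun p _ => by positivity) hint η
    rw [integral_finsetSum _ fun p _ => integrable_scaledGaussian_pow p 4] at h
    simp only [integral_scaledGaussian_pow_four, Finset.sum_const, Finset.card_univ,
      Fintype.card_prod, Fintype.card_fin, nsmul_eq_mul, Nat.cast_mul] at h
    have hN' : (0 : ℝ) < N := by exact_mod_cast hN
    rw [← ofReal_measureReal]
    refine ENNReal.ofReal_le_ofReal ?_
    rw [le_div_iff₀ hη]
    refine le_trans (le_of_eq ?_) (h.trans (le_of_eq ?_))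
    · rw [mul_comm]
    · field_simp
  have hlim : Tendsto (fun N : ℕ => ENNReal.ofReal (m * gaussMomentFour / N / η)) atTop
      (nhds (ENNReal.ofReal (0 / η))) :=
    ENNReal.tendsto_ofReal (Tendsto.div_const (tendsto_const_div_atTop_nhds_zero_nat _) _)
  simp only [zero_div, ENNReal.ofReal_zero] at hlim
  exact tendsto_of_tendsto_of_tendsto_of_le_of_le' tendsto_const_nhds hlim
    (Eventually.of_forall fun _ => zero_le) hb

end Moments

section Density

variable {ι : Type*} [Fintype ι]

lemma pi_withDensity {μ : ι → Measure ℝ} [∀ i, IsProbabilityMeasure (μ i)]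
    {f : ι → ℝ → ℝ≥0∞} (hf : ∀ i, Measurable (f i))
    [∀ i, SigmaFinite ((μ i).withDensity (f i))] :
    Measure.pi (fun i => (μ i).withDensity (f i)) =
      (Measure.pi μ).withDensity fun x => ∏ i, f i (x i) := by
  refine Measure.pi_eq fun s hs => ?_
  have hS : MeasurableSet (Set.univ.pi s) := MeasurableSet.univ_pi hs
  rw [withDensity_apply _ hS, ← lintegral_indicator hS]
  have h : ∀ x : ι → ℝ, (Set.univ.pi s).indicator (fun x => ∏ i, f i (x i)) x =
      ∏ i, (s i).indicator (f i) (x i) := by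
    intro x
    by_cases hx : x ∈ Set.univ.pi s
    · rw [Set.indicator_of_mem hx]
      refine Finset.prod_congr rfl fun i _ => ?_
      rw [Set.indicator_of_mem (hx i (Set.mem_univ i))]
    · rw [Set.indicator_of_notMem hx]
      simp only [Set.mem_univ_pi, not_forall] at hx
      obtain ⟨i, hi⟩ := hx
      exact (Finset.prod_eq_zero (Finset.mem_univ i) (Set.indicator_of_notMem hi _)).symm
  simp only [h]
  have hind := lintegral_prod_eq_prod_lintegral_of_indepFun (μ := Measure.pi μ) Finset.univ
    (fun i (x : ι → ℝ) => (s i).indicator (f i) (x i))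
    (iIndepFun_pi (X := fun i => (s i).indicator (f i))
      fun i => ((hf i).indicator (hs i)).aemeasurable)
    (fun i => ((hf i).indicator (hs i)).comp (measurable_pi_apply i))
  rw [hind]
  refine Finset.prod_congr rfl fun i _ => ?_
  rw [withDensity_apply _ (hs i), ← lintegral_indicator (hs i)]
  exact (measurePreserving_eval μ i).lintegral_comp ((hf i).indicator (hs i))

lemma map_mul_gaussianReal {v : ℝ≥0} (hv : v ≠ 0) {t : ℝ} (ht : 0 < t) :
    (gaussianReal 0 v).map (fun x => t * x) = (gaussianReal 0 v).withDensity
      (fun x => ENNReal.ofReal (t⁻¹ * Real.exp ((1 - (t ^ 2)⁻¹) * (x ^ 2 / (2 * v))))) := by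
  have hv' : (0 : ℝ) < v := by positivity
  rw [gaussianReal_map_const_mul, mul_zero, gaussianReal_of_var_ne_zero 0 hv,
    gaussianReal_of_var_ne_zero, ← withDensity_mul _ (by fun_prop) (by fun_prop)]
  · congr 1
    ext x
    simp only [Pi.mul_apply, gaussianPDF, gaussianPDFReal, sub_zero]
    rw [← ENNReal.ofReal_mul (by positivity)]
    congr 1
    have h1 : √(2 * Real.pi * (t ^ 2 * v)) = t * √(2 * Real.pi * v) := by
      rw [show 2 * Real.pi * (t ^ 2 * v) = t ^ 2 * (2 * Real.pi * v) by ring,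
        Real.sqrt_mul (by positivity), Real.sqrt_sq ht.le]
    simp only [NNReal.coe_mul, NNReal.coe_mk]
    rw [h1, mul_inv]
    rw [show t⁻¹ * (√(2 * Real.pi * v))⁻¹ * Real.exp (-x ^ 2 / (2 * (t ^ 2 * v))) =
      (√(2 * Real.pi * v))⁻¹ * (t⁻¹ * Real.exp (-x ^ 2 / (2 * (t ^ 2 * v)))) by ring]
    rw [show (√(2 * Real.pi * v))⁻¹ * Real.exp (-x ^ 2 / (2 * v)) *
      (t⁻¹ * Real.exp ((1 - (t ^ 2)⁻¹) * (x ^ 2 / (2 * v)))) = (√(2 * Real.pi * v))⁻¹ *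
      (t⁻¹ * (Real.exp (-x ^ 2 / (2 * v)) * Real.exp ((1 - (t ^ 2)⁻¹) * (x ^ 2 / (2 * v)))))
      by ring, ← Real.exp_add]
    congr 3
    field_simp
    ring
  · refine mul_ne_zero ?_ hv
    intro h
    have := congrArg NNReal.toReal h
    simp [ht.ne'] at this

lemma map_smul_pi_gaussianReal {v : ℝ≥0} (hv : v ≠ 0) {t : ℝ} (ht : 0 < t) :
    (Measure.pi fun _ : ι => gaussianReal 0 v).map (fun x => t • x) =
      (Measure.pi fun _ : ι => gaussianReal 0 v).withDensity (fun x => ENNReal.ofReal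
        (t⁻¹ ^ Fintype.card ι * Real.exp ((1 - (t ^ 2)⁻¹) * ∑ i, x i ^ 2 / (2 * v)))) := by
  have : IsProbabilityMeasure ((gaussianReal 0 v).map (fun x => t * x)) :=
    Measure.isProbabilityMeasure_map (by fun_prop)
  have h : (Measure.pi fun _ : ι => gaussianReal 0 v).map (fun x => t • x) =
      Measure.pi fun _ : ι => (gaussianReal 0 v).map (fun x => t * x) :=
    Measure.pi_map_pi (f := fun _ x => t * x) (fun _ => by fun_prop)
  rw [h]
  have : SigmaFinite ((gaussianReal 0 v).withDensity
      (fun x => ENNReal.ofReal (t⁻¹ * Real.exp ((1 - (t ^ 2)⁻¹) * (x ^ 2 / (2 * v)))))) := by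
    rw [← map_mul_gaussianReal hv ht]; infer_instance
  simp only [map_mul_gaussianReal hv ht]
  rw [pi_withDensity (fun _ => by fun_prop)]
  congr 1
  ext x
  rw [← ENNReal.ofReal_prod_of_nonneg (fun i _ => by positivity), Finset.prod_mul_distrib,
    Finset.prod_const, Finset.card_univ, ← Real.exp_sum, Finset.mul_sum]

/-- A measurable set meeting almost every short ray segment in a null set is Gaussian null. -/
lemma pi_gaussianReal_eq_zero_of_forall_ray {v : ℝ≥0} (hv : v ≠ 0) {S : Set (ι → ℝ)}
    (hS : MeasurableSet S)
    (h : ∀ w : ι → ℝ, ∀ᵐ t ∂(volume.restrict (Set.Ioo (0 : ℝ) 1)), t • w ∉ S) :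
    (Measure.pi fun _ : ι => gaussianReal 0 v) S = 0 := by
  set P : Measure (ι → ℝ) := Measure.pi fun _ : ι => gaussianReal 0 v with hP
  set lam : Measure ℝ := volume.restrict (Set.Ioo (0 : ℝ) 1) with hlam
  have hm : MeasurableSet {q : (ι → ℝ) × ℝ | q.2 • q.1 ∈ S} :=
    hS.preimage (by fun_prop : Measurable fun q : (ι → ℝ) × ℝ => q.2 • q.1)
  have h0 : (P.prod lam) {q | q.2 • q.1 ∈ S} = 0 := by
    rw [Measure.measure_prod_null hm]
    filter_upwards with w
    have := h w
    rw [ae_iff] at this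
    simpa using this
  have h1 : ∀ᵐ t ∂lam, P {w | t • w ∈ S} = 0 := by
    have h2 : (lam.prod P) (Prod.swap ⁻¹' {q : (ι → ℝ) × ℝ | q.2 • q.1 ∈ S}) = 0 := by
      rw [← Measure.map_apply measurable_swap hm, Measure.prod_swap, h0]
    exact Measure.measure_ae_null_of_prod_null h2
  have h3 : ∀ᵐ t ∂lam, t ∈ Set.Ioo (0 : ℝ) 1 := ae_restrict_mem measurableSet_Ioo
  have hne : lam ≠ 0 := by simp [hlam]
  have : NeZero lam := ⟨hne⟩
  obtain ⟨t, ht1, ht2⟩ := (h1.and h3).exists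
  have h4 : P.map (fun x => t • x) S = 0 := by
    rw [Measure.map_apply (by fun_prop) hS]
    exact ht1
  have ht0 := ht2.1
  have hmeas : Measurable fun x : ι → ℝ => ENNReal.ofReal (t⁻¹ ^ Fintype.card ι *
      Real.exp ((1 - (t ^ 2)⁻¹) * ∑ i, x i ^ 2 / (2 * v))) := by fun_prop
  rw [hP, map_smul_pi_gaussianReal hv ht0, withDensity_apply_eq_zero' hmeas.aemeasurable] at h4
  have h5 : {x : ι → ℝ | ENNReal.ofReal (t⁻¹ ^ Fintype.card ι *
      Real.exp ((1 - (t ^ 2)⁻¹) * ∑ i, x i ^ 2 / (2 * v))) ≠ 0} = Set.univ := by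
    ext x
    simp only [ne_eq, ENNReal.ofReal_eq_zero, not_le, Set.mem_ofPred_eq, Set.mem_univ, iff_true]
    positivity
  rwa [h5, Set.univ_inter] at h4

end Density

section Rays

variable {c n : ℕ}

/-- The integral of `hessAct V` against an exponentially tilted Gaussian. -/
noncomputable def tiltHess (V : Matrix (Fin c) (Fin n) ℝ) (s : ℝ) : Matrix (Fin n) (Fin n) ℝ :=
  Matrix.of fun i j =>
    ∫ u, hessAct V u i j * Real.exp (s * ∑ i, u i ^ 2 / (2 * (1 : ℝ≥0))) ∂(inputMeasure n)

lemma hessAct_smul (V : Matrix (Fin c) (Fin n) ℝ) {t : ℝ} (ht : 0 < t) (u : Fin n → ℝ)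
    (i j : Fin n) : hessAct (t • V) u i j = t ^ 2 * hessAct V (t • u) i j := by
  have h1 : ((t • V) *ᵥ fun i => max (u i) 0) = V *ᵥ fun i => max ((t • u) i) 0 := by
    rw [Matrix.smul_mulVec, ← Matrix.mulVec_smul]
    congr 1
    ext i
    simp only [Pi.smul_apply, smul_eq_mul]
    rw [mul_max_of_nonneg _ _ ht.le, mul_zero]
  have h2 : ∀ i, 0 ≤ t * u i ↔ 0 ≤ u i := fun i => mul_nonneg_iff_of_pos_left ht
  simp only [hessAct_apply, h1, Pi.smul_apply, smul_eq_mul, h2, Matrix.smul_apply]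
  rw [mul_left_comm (t ^ 2)]
  congr 1
  rw [Finset.mul_sum]
  refine Finset.sum_congr rfl fun k _ => ?_
  rw [Finset.mul_sum]
  refine Finset.sum_congr rfl fun l _ => ?_
  ring

lemma limHess_smul (V : Matrix (Fin c) (Fin n) ℝ) {t : ℝ} (ht : 0 < t) :
    limHess (t • V) = (t ^ 2 * t⁻¹ ^ n) • tiltHess V (1 - (t ^ 2)⁻¹) := by
  ext i j
  simp only [limHess, tiltHess, Matrix.of_apply, Matrix.smul_apply, hessAct_smul V ht, smul_eq_mul]
  rw [integral_const_mul, mul_assoc]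
  congr 1
  have hm : Measurable fun u : Fin n → ℝ => t • u := by fun_prop
  have h := integral_map (μ := inputMeasure n) hm.aemeasurable
      (measurable_hessAct V i j).aestronglyMeasurable
  rw [← h, inputMeasure, map_smul_pi_gaussianReal one_ne_zero ht,
    integral_withDensity_eq_integral_toReal_smul (by fun_prop) (by simp), ← integral_const_mul]
  congr 1
  ext u
  rw [ENNReal.toReal_ofReal (by positivity), smul_eq_mul, Fintype.card_fin]
  ring

lemma Iio_subset_integrableExpSet {Ω : Type*} [MeasurableSpace Ω] {X : Ω → ℝ} {μ : Measure Ω}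
    [IsFiniteMeasure μ] (hX : Measurable X) (h0 : ∀ ω, 0 ≤ X ω) :
    Set.Iio 0 ⊆ interior (integrableExpSet X μ) := by
  refine interior_maximal (fun s hs => ?_) isOpen_Iio
  refine Integrable.of_bound (by fun_prop) 1 (ae_of_all _ fun ω => ?_)
  rw [Real.norm_eq_abs, Real.abs_exp, Real.exp_le_one_iff]
  exact mul_nonpos_of_nonpos_of_nonneg (le_of_lt hs) (h0 ω)

lemma analyticOnNhd_integral_mul_exp {Ω : Type*} [MeasurableSpace Ω] {X f : Ω → ℝ}
    {μ : Measure Ω} [IsFiniteMeasure μ] (hX : Measurable X) (h0 : ∀ ω, 0 ≤ X ω)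
    (hf : Measurable f) {C : ℝ} (hC : ∀ ω, |f ω| ≤ C) :
    AnalyticOnNhd ℝ (fun s => ∫ ω, f ω * Real.exp (s * X ω) ∂μ) (Set.Iio 0) := by
  set ν := μ.withDensity fun ω => ENNReal.ofReal (f ω + C) with hν
  have hb : ∀ ω, 0 ≤ f ω + C := fun ω => by linarith [neg_abs_le (f ω), hC ω]
  have hfin : IsFiniteMeasure ν := by
    refine isFiniteMeasure_withDensity_ofReal ?_
    exact (Integrable.of_bound (by fun_prop) (C + C) (ae_of_all _ fun ω => by
      rw [Real.norm_eq_abs, abs_of_nonneg (hb ω)]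
      linarith [le_abs_self (f ω), hC ω])).2
  have h1 : AnalyticOnNhd ℝ (mgf X ν) (Set.Iio 0) :=
    analyticOnNhd_mgf.mono (Iio_subset_integrableExpSet hX h0)
  have h2 : AnalyticOnNhd ℝ (mgf X μ) (Set.Iio 0) :=
    analyticOnNhd_mgf.mono (Iio_subset_integrableExpSet hX h0)
  refine (h1.sub (h2.const_smul (c := C))).congr isOpen_Iio fun s hs => ?_
  have hint : Integrable (fun ω => Real.exp (s * X ω)) μ :=
    (interior_subset (Iio_subset_integrableExpSet (μ := μ) hX h0 hs) :
      s ∈ integrableExpSet X μ)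
  have hint2 : Integrable (fun ω => f ω * Real.exp (s * X ω)) μ :=
    hint.bdd_mul (c := C) hf.aestronglyMeasurable (ae_of_all _ hC)
  simp only [Pi.sub_apply, Pi.smul_apply, smul_eq_mul, mgf]
  rw [hν, integral_withDensity_eq_integral_toReal_smul (by fun_prop) (by simp)]
  simp only [ENNReal.toReal_ofReal (hb _), smul_eq_mul, add_mul]
  rw [integral_add hint2 (hint.const_mul C), integral_const_mul]
  ring

lemma analyticOnNhd_tiltHess (V : Matrix (Fin c) (Fin n) ℝ) (i j : Fin n) :
    AnalyticOnNhd ℝ (fun s => tiltHess V s i j) (Set.Iio 0) :=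
  analyticOnNhd_integral_mul_exp (by fun_prop)
    (fun u => Finset.sum_nonneg fun _ _ => by positivity) (measurable_hessAct V i j)
    (abs_hessAct_le V · i j)

lemma frob2_smul {m k : ℕ} (a : ℝ) (A : Matrix (Fin m) (Fin k) ℝ) :
    frob2 (a • A) = a ^ 2 * frob2 A := by
  simp only [frob2, Matrix.smul_apply, smul_eq_mul, mul_pow, Finset.mul_sum]

lemma frob2_transpose {m k : ℕ} (A : Matrix (Fin m) (Fin k) ℝ) : frob2 Aᵀ = frob2 A := by
  simp only [frob2, Matrix.transpose_apply]
  exact Finset.sum_comm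

lemma frob2_mul_le {m k l : ℕ} (A : Matrix (Fin m) (Fin k) ℝ) (B : Matrix (Fin k) (Fin l) ℝ) :
    frob2 (A * B) ≤ frob2 A * frob2 B := by
  have h : frob2 A * frob2 B = ∑ i, ∑ j, (∑ r, A i r ^ 2) * ∑ r, B r j ^ 2 := by
    rw [← frob2_transpose B]
    simp only [frob2, Matrix.transpose_apply, Finset.sum_mul_sum]
  rw [h]
  refine Finset.sum_le_sum fun i _ => Finset.sum_le_sum fun j _ => ?_
  rw [Matrix.mul_apply]
  exact Finset.sum_mul_sq_le_sq_mul_sq _ _ _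

lemma frob2_conj_le {m k : ℕ} (W : Matrix (Fin m) (Fin k) ℝ) (M : Matrix (Fin k) (Fin k) ℝ) :
    frob2 (W * M * Wᵀ) ≤ frob2 W ^ 2 * frob2 M := by
  refine (frob2_mul_le _ _).trans ?_
  rw [frob2_transpose]
  have := mul_le_mul_of_nonneg_right (frob2_mul_le W M) (frob2_nonneg W)
  linarith

lemma projRatio_limHess_smul (V : Matrix (Fin c) (Fin n) ℝ) {t : ℝ} (ht : 0 < t) :
    projRatio (t • V) (limHess (t • V)) =
      t ^ 4 * frob2 (V * tiltHess V (1 - (t ^ 2)⁻¹) * Vᵀ) /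
        frob2 (tiltHess V (1 - (t ^ 2)⁻¹)) := by
  have ha : t ^ 2 * t⁻¹ ^ n ≠ 0 := by positivity
  rw [limHess_smul V ht, projRatio]
  simp only [Matrix.transpose_smul, Matrix.smul_mul, Matrix.mul_smul, frob2_smul]
  field_simp

lemma ae_projRatio_smul_ne (V : Matrix (Fin c) (Fin n) ℝ) {κ : ℝ} (hκ : 0 < κ) :
    ∀ᵐ t ∂(volume.restrict (Set.Ioo (0 : ℝ) 1)),
      projRatio (t • V) (limHess (t • V)) ≠ κ := by
  set N : ℝ → Matrix (Fin n) (Fin n) ℝ := fun t => tiltHess V (1 - (t ^ 2)⁻¹) with hN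
  have hNa : ∀ i j, AnalyticOnNhd ℝ (fun t => N t i j) (Set.Ioo 0 1) := by
    intro i j
    refine (analyticOnNhd_tiltHess V i j).comp (f := fun t : ℝ => 1 - (t ^ 2)⁻¹) ?_ ?_
    · intro t ht
      have : t ^ 2 ≠ 0 := pow_ne_zero 2 ht.1.ne'
      fun_prop (disch := assumption)
    · intro t ht
      have h1 : t ^ 2 < 1 := by nlinarith [ht.1, ht.2]
      have h2 : 1 < (t ^ 2)⁻¹ := (one_lt_inv₀ (by have := ht.1; positivity)).2 h1
      simp only [Set.mem_Iio]
      linarith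
  have hfN : AnalyticOnNhd ℝ (fun t => frob2 (N t)) (Set.Ioo 0 1) := by
    unfold frob2
    exact Finset.analyticOnNhd_fun_sum _ fun i _ => Finset.analyticOnNhd_fun_sum _ fun j _ =>
      (hNa i j).pow 2
  have hfVN : AnalyticOnNhd ℝ (fun t => frob2 (V * N t * Vᵀ)) (Set.Ioo 0 1) := by
    unfold frob2
    refine Finset.analyticOnNhd_fun_sum _ fun i _ => Finset.analyticOnNhd_fun_sum _ fun j _ => ?_
    refine AnalyticOnNhd.pow ?_ 2
    simp only [Matrix.mul_apply]
    exact Finset.analyticOnNhd_fun_sum _ fun k _ => (Finset.analyticOnNhd_fun_sum _ fun l _ =>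
      analyticOnNhd_const.mul (hNa l k)).mul analyticOnNhd_const
  have hG : AnalyticOnNhd ℝ (fun t => t ^ 4 * frob2 (V * N t * Vᵀ) - κ * frob2 (N t))
      (Set.Ioo 0 1) :=
    ((analyticOnNhd_id.pow 4).mul hfVN).sub (analyticOnNhd_const.mul hfN)
  rcases hG.eqOn_zero_or_eventually_ne_zero_of_preconnected isPreconnected_Ioo with h | h
  · have hz : Set.EqOn (fun t => frob2 (N t)) 0 (Set.Ioo 0 1) := by
      have hlim : Tendsto (fun t : ℝ => t ^ 4 * frob2 V ^ 2) (nhdsWithin 0 (Set.Ioi 0))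
          (nhds 0) := by
        have : Continuous fun t : ℝ => t ^ 4 * frob2 V ^ 2 := by fun_prop
        simpa using (this.tendsto 0).mono_left nhdsWithin_le_nhds
      have hev : ∀ᶠ t in nhdsWithin (0 : ℝ) (Set.Ioi 0),
          t ^ 4 * frob2 V ^ 2 < κ ∧ t ∈ Set.Ioo (0 : ℝ) 1 :=
        (hlim.eventually_lt_const hκ).and (Ioo_mem_nhdsGT one_pos)
      have hzero : ∀ t, (t ^ 4 * frob2 V ^ 2 < κ ∧ t ∈ Set.Ioo (0 : ℝ) 1) →
          frob2 (N t) = 0 := by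
        rintro t ⟨ht1, ht2⟩
        have h1 : t ^ 4 * frob2 (V * N t * Vᵀ) - κ * frob2 (N t) = 0 := h ht2
        have h2 := mul_le_mul_of_nonneg_left (frob2_conj_le V (N t)) (by positivity : 0 ≤ t ^ 4)
        by_contra h3
        have h4 : 0 < frob2 (N t) := lt_of_le_of_ne (frob2_nonneg _) (Ne.symm h3)
        nlinarith
      rw [eventually_nhdsWithin_iff] at hev
      obtain ⟨δ, hδ, hball⟩ := Metric.eventually_nhds_iff.1 hev
      have hmem : ∀ t, 0 < t → t < δ → frob2 (N t) = 0 := fun t h0 h1 =>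
        hzero t (hball (by rw [Real.dist_eq, sub_zero, abs_of_pos h0]; exact h1) h0)
      have hd : 0 < min δ 1 := lt_min hδ one_pos
      refine hfN.eqOn_zero_of_preconnected_of_eventuallyEq_zero isPreconnected_Ioo
        (z₀ := min δ 1 / 2) ⟨by linarith, by linarith [min_le_right δ 1]⟩ ?_
      filter_upwards [Ioo_mem_nhds (a := 0) (b := min δ 1) (by linarith) (by linarith)]
        with t ht
      exact hmem t ht.1 (ht.2.trans_le (min_le_left _ _))
    filter_upwards [ae_restrict_mem measurableSet_Ioo] with t ht
    have : frob2 (tiltHess V (1 - (t ^ 2)⁻¹)) = 0 := hz ht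
    rw [projRatio_limHess_smul V ht.1, this, div_zero]
    exact hκ.ne
  · filter_upwards [ae_restrict_mem measurableSet_Ioo,
      ae_restrict_le_codiscreteWithin measurableSet_Ioo h] with t ht h1 h2
    apply h1
    rw [projRatio_limHess_smul V ht.1] at h2
    have h3 : frob2 (N t) ≠ 0 := by
      intro h0
      simp only [hN] at h0
      rw [h0, div_zero] at h2
      exact hκ.ne h2
    rw [div_eq_iff h3] at h2
    exact sub_eq_zero.2 h2

lemma measurable_limHess (i j : Fin n) :
    Measurable fun w : (Fin c × Fin n) → ℝ => limHess (W2of w) i j :=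
  (StronglyMeasurable.integral_prod_right
    (measurable_hessAct_uncurry i j).stronglyMeasurable).measurable

lemma measurable_projRatio_limHess :
    Measurable fun w : (Fin c × Fin n) → ℝ => projRatio (W2of w) (limHess (W2of w)) := by
  have hW : ∀ k i, Measurable fun w : (Fin c × Fin n) → ℝ => W2of w k i :=
    fun k i => measurable_pi_apply (k, i)
  unfold projRatio frob2
  refine Measurable.div ?_ ?_
  · simp only [Matrix.mul_apply, Matrix.transpose_apply]
    refine Finset.measurable_sum _ fun i _ => Finset.measurable_sum _ fun j _ =>
      Measurable.pow_const (Finset.measurable_sum _ fun k _ => Measurable.mul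
        (Finset.measurable_sum _ fun l _ => (hW _ _).mul (measurable_limHess _ _)) (hW _ _)) 2
  · exact Finset.measurable_sum _ fun i _ => Finset.measurable_sum _ fun j _ =>
      (measurable_limHess i j).pow_const 2

/-- The limiting ratio has no atoms away from zero. -/
lemma ae_projRatio_limHess_ne (hn : 0 < n) {κ : ℝ} (hκ : 0 < κ) :
    ∀ᵐ w ∂(scaledGaussian c n), projRatio (W2of w) (limHess (W2of w)) ≠ κ := by
  rw [ae_iff]
  simp only [ne_eq, not_not]
  refine pi_gaussianReal_eq_zero_of_forall_ray (by positivity)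
    (measurable_projRatio_limHess (measurableSet_singleton κ)) fun w => ?_
  exact ae_projRatio_smul_ne (W2of w) hκ

end Rays

section InnerLimit

variable {c n : ℕ}

lemma limHess_ne_zero (W : Matrix (Fin c) (Fin n) ℝ) {a b : Fin c} {i : Fin n}
    (h : W a i ≠ W b i) : limHess W ≠ 0 := by
  have hab : a ≠ b := fun e => h (by rw [e])
  have hlow : ∀ u : Fin n → ℝ, (if 0 ≤ u i then (1 : ℝ) else 0) *
      (softmaxFn (W *ᵥ fun i => max (u i) 0) a * softmaxFn (W *ᵥ fun i => max (u i) 0) b *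
        (W a i - W b i) ^ 2) ≤ hessAct W u i i := by
    intro u
    have := Amat_quadForm_ge (W *ᵥ fun i => max (u i) 0) (fun k => W k i) hab
    rw [hessAct_apply]
    split_ifs
    · simpa using this
    · simp
  have hnn : ∀ u : Fin n → ℝ, 0 ≤ (if 0 ≤ u i then (1 : ℝ) else 0) *
      (softmaxFn (W *ᵥ fun i => max (u i) 0) a * softmaxFn (W *ᵥ fun i => max (u i) 0) b *
        (W a i - W b i) ^ 2) := fun u => by
    have h1 := softmaxFn_pos (W *ᵥ fun i => max (u i) 0) a
    have h2 := softmaxFn_pos (W *ᵥ fun i => max (u i) 0) b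
    split_ifs <;> positivity
  intro h0
  have h1 : ∫ u, hessAct W u i i ∂(inputMeasure n) = 0 := by
    have := congrFun (congrFun h0 i) i
    simpa [limHess] using this
  rw [integral_eq_zero_iff_of_nonneg (fun u => (hnn u).trans (hlow u))
    (integrable_hessAct W i i _)] at h1
  have h2 : ∀ᵐ u ∂(inputMeasure n), u i ∈ Set.Iio (0 : ℝ) := by
    filter_upwards [h1] with u hu
    by_contra hcon
    have hui : 0 ≤ u i := not_lt.1 hcon
    have h3 := hlow u
    rw [hu, if_pos hui, one_mul] at h3
    have h4 := softmaxFn_pos (W *ᵥ fun i => max (u i) 0) a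
    have h5 := softmaxFn_pos (W *ᵥ fun i => max (u i) 0) b
    have h6 : 0 < (W a i - W b i) ^ 2 := by
      have := sub_ne_zero.2 h
      positivity
    have : 0 < softmaxFn (W *ᵥ fun i => max (u i) 0) a *
      softmaxFn (W *ᵥ fun i => max (u i) 0) b * (W a i - W b i) ^ 2 := by positivity
    exact absurd h3 (not_le.2 this)
  have h3 : ∀ᵐ x ∂(gaussianReal 0 1), x ∈ Set.Iio (0 : ℝ) := by
    rw [← (measurePreserving_eval (fun _ : Fin n => gaussianReal 0 1) i).map_eq]
    exact (ae_map_iff (measurable_pi_apply i).aemeasurable measurableSet_Iio).2 h2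
  have h4 := gaussianReal_absolutelyContinuous' 0 (one_ne_zero (α := ℝ≥0)) (ae_iff.1 h3)
  have h5 : {a : ℝ | a ∉ Set.Iio (0 : ℝ)} = Set.Ici 0 := by ext; simp
  rw [h5] at h4
  simp at h4

lemma ae_scaledGaussian_eval_ne {m N : ℕ} (hN : 0 < N) {p q : Fin m × Fin N} (hpq : p ≠ q) :
    ∀ᵐ w ∂(scaledGaussian m N), w p ≠ w q := by
  have h := (iIndepFun_scaledGaussian (m := m) (N := N)).indepFun hpq
  rw [indepFun_iff_map_prod_eq_prod_map_map (measurable_pi_apply p).aemeasurable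
    (measurable_pi_apply q).aemeasurable, (measurePreserving_scaledGaussian_eval p).map_eq,
    (measurePreserving_scaledGaussian_eval q).map_eq] at h
  have hv : ((N : ℝ≥0)⁻¹) ≠ 0 := by positivity
  have := nullSingletonClass_gaussianReal (μ := 0) hv
  have hd : MeasurableSet {x : ℝ × ℝ | x.1 = x.2} :=
    measurableSet_eq_fun measurable_fst measurable_snd
  have h0 : (Measure.map (fun w : (Fin m × Fin N) → ℝ => (w p, w q)) (scaledGaussian m N))
      {x : ℝ × ℝ | x.1 = x.2} = 0 := by
    rw [h, Measure.measure_prod_null hd]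
    filter_upwards with x
    have : Prod.mk x ⁻¹' {x : ℝ × ℝ | x.1 = x.2} = {x} := by
      ext y; simp [eq_comm]
    rw [this]
    simp
  rw [Measure.map_apply (by fun_prop) hd] at h0
  rw [ae_iff]
  simpa using h0

lemma ae_limHess_ne_zero (hc : 2 ≤ c) (hn : 0 < n) :
    ∀ᵐ w ∂(scaledGaussian c n), limHess (W2of w) ≠ 0 := by
  filter_upwards [ae_scaledGaussian_eval_ne hn
    (p := ((⟨0, by omega⟩ : Fin c), (⟨0, hn⟩ : Fin n))) (q := ((⟨1, by omega⟩ : Fin c), ⟨0, hn⟩))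
    (by simp)] with w hw
  exact limHess_ne_zero (W2of w) hw

lemma continuousAt_projRatio (W : Matrix (Fin c) (Fin n) ℝ) {M : Matrix (Fin n) (Fin n) ℝ}
    (hM : M ≠ 0) : ContinuousAt (projRatio W) M := by
  refine ContinuousAt.div ?_ continuous_frob2.continuousAt (frob2_eq_zero.not.2 hM)
  exact (continuous_frob2.comp (by fun_prop : Continuous fun M : Matrix (Fin n) (Fin n) ℝ => W * M * Wᵀ)).continuousAt

lemma eventually_lt_abs_sub_iff {α : Type*} {l : Filter α} {f : α → ℝ} {R ε : ℝ}
    (hf : Tendsto f l (nhds R)) (h0 : ∀ a, 0 ≤ f a) (hR : 0 ≤ R) (h1 : R ≠ 1 + ε)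
    (h2 : 0 < 1 - ε → R ≠ 1 - ε) :
    ∀ᶠ a in l, (ε < |f a - 1| ↔ ε < |R - 1|) := by
  have ht : Tendsto (fun a => |f a - 1|) l (nhds |R - 1|) := (hf.sub_const 1).abs
  rcases lt_trichotomy ε |R - 1| with h | h | h
  · filter_upwards [ht.eventually_const_lt h] with a ha
    simp [h, ha]
  · have hR0 : R = 0 ∧ ε = 1 := by
      rcases abs_cases (R - 1) with h3 | h3
      · exact absurd (by linarith) h1
      · have h4 : R = 1 - ε := by linarith
        by_cases h5 : 0 < 1 - ε
        · exact absurd h4 (h2 h5)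
        · constructor <;> linarith
    filter_upwards [hf.eventually_lt_const (show R < 1 by linarith [hR0.1])] with a ha
    have : |f a - 1| ≤ ε := by
      rw [abs_le]
      constructor <;> linarith [h0 a, hR0.2]
    simp [← h, this]
  · filter_upwards [ht.eventually_lt_const h] with a ha
    exact iff_of_false (not_lt.2 ha.le) (not_lt.2 h.le)

lemma exists_entrywise_of_eventually_nhdsWithin {P : Matrix (Fin n) (Fin n) ℝ → Prop}
    {s : Set (Matrix (Fin n) (Fin n) ℝ)} {G₀ : Matrix (Fin n) (Fin n) ℝ}
    (h : ∀ᶠ G in nhdsWithin G₀ s, P G) :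
    ∃ η > 0, ∀ G ∈ s, (∀ k l, |G k l - G₀ k l| < η) → P G := by
  rw [eventually_nhdsWithin_iff] at h
  obtain ⟨η, hη, hb⟩ := (Metric.eventually_nhds_iff (α := Fin n → Fin n → ℝ)).1 h
  refine ⟨η, hη, fun G hG hd => hb ?_ hG⟩
  exact (dist_pi_lt_iff hη).2 fun k => (dist_pi_lt_iff hη).2 fun l => hd k l

lemma tendsto_measure_of_tendsto_iff {α : ℕ → Type*} [∀ d, MeasurableSpace (α d)]
    {μ : ∀ d, Measure (α d)} [∀ d, IsProbabilityMeasure (μ d)] {E B : ∀ d, Set (α d)}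
    (hB : Tendsto (fun d => μ d (B d)) atTop (nhds 0)) (Q : Prop) [Decidable Q]
    (h : ∀ d, ∀ x ∉ B d, (x ∈ E d ↔ Q)) :
    Tendsto (fun d => μ d (E d)) atTop (nhds (if Q then 1 else 0)) := by
  split_ifs with hQ
  · have h1 : Tendsto (fun d => 1 - μ d (B d)) atTop (nhds (1 - 0)) :=
      ENNReal.Tendsto.sub tendsto_const_nhds hB (by simp)
    rw [tsub_zero] at h1
    refine tendsto_of_tendsto_of_tendsto_of_le_of_le h1 tendsto_const_nhds (fun d => ?_)
      fun d => prob_le_one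
    rw [tsub_le_iff_right]
    calc (1 : ℝ≥0∞) = μ d Set.univ := measure_univ.symm
      _ ≤ μ d (E d ∪ B d) := measure_mono fun x _ => by
        by_cases hx : x ∈ B d
        · exact Or.inr hx
        · exact Or.inl ((h d x hx).2 hQ)
      _ ≤ _ := measure_union_le _ _
  · refine tendsto_of_tendsto_of_tendsto_of_le_of_le tendsto_const_nhds hB (fun d => zero_le)
      fun d => measure_mono fun x hx => ?_
    by_contra hxB
    exact hQ ((h d x hxB).1 hx)

lemma tendsto_measure_outputHessian (w2 : (Fin c × Fin n) → ℝ) {ε : ℝ}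
    (hM : limHess (W2of w2) ≠ 0)
    (h1 : projRatio (W2of w2) (limHess (W2of w2)) ≠ 1 + ε)
    (h2 : 0 < 1 - ε → projRatio (W2of w2) (limHess (W2of w2)) ≠ 1 - ε) :
    Tendsto (fun d => scaledGaussian n d
      {w1 | ε < |projRatio (W2of w2) (outputHessian c d n (w1, w2)) - 1|}) atTop
      (nhds ({w | ε < |projRatio (W2of w) (limHess (W2of w)) - 1|}.indicator 1 w2)) := by
  classical
  obtain ⟨F, hF, hFG⟩ := exists_tendsto_outputHessian (W2of w2)
  have hev := eventually_lt_abs_sub_iff (ε := ε)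
    ((continuousAt_projRatio (W2of w2) hM).tendsto.comp hF)
    (fun _ => projRatio_nonneg _ _) (projRatio_nonneg _ _) h1 h2
  obtain ⟨η, hη, hG⟩ := exists_entrywise_of_eventually_nhdsWithin hev
  rw [Set.indicator_apply]
  refine tendsto_measure_of_tendsto_iff (tendsto_measure_gram n hη) _ fun d w1 hw1 => ?_
  have hps : (W1of w1 * (W1of w1)ᵀ).PosSemidef := by
    have := Matrix.posSemidef_self_mul_conjTranspose (W1of w1)
    rwa [Matrix.conjTranspose_eq_transpose_of_trivial] at this
  have h3 := hG _ hps fun k l => not_le.1 fun h => hw1 ⟨k, l, h⟩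
  have h4 := hFG d (w1, w2) rfl
  simp only [Function.comp_apply] at h3
  simp only [Set.mem_ofPred_eq, h4]
  exact h3

lemma measurable_outputHessian (d : ℕ) (i j : Fin n) :
    Measurable fun w : ((Fin n × Fin d) → ℝ) × ((Fin c × Fin n) → ℝ) =>
      outputHessian c d n w i j := by
  have hm : Measurable fun q : (((Fin n × Fin d) → ℝ) × ((Fin c × Fin n) → ℝ)) × (Fin d → ℝ) =>
      hessOne q.1 q.2 i j := by
    have h : Measurable fun q : (((Fin n × Fin d) → ℝ) × ((Fin c × Fin n) → ℝ)) ×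
        (Fin d → ℝ) => (q.1.2, W1of q.1.1 *ᵥ q.2) := by
      refine Measurable.prodMk (by fun_prop) (measurable_pi_lambda _ fun i => ?_)
      simp only [Matrix.mulVec, dotProduct, W1of, Matrix.of_apply]
      fun_prop
    have h2 := (measurable_hessAct_uncurry (c := c) i j).comp h
    simpa only [hessOne_eq_hessAct, Function.comp_def] using h2
  have h3 := (StronglyMeasurable.integral_prod_right' (ν := inputMeasure d)
    hm.stronglyMeasurable).measurable
  simpa only [outputHessian, Matrix.of_apply] using h3

lemma measurable_projRatio_outputHessian (d : ℕ) :
    Measurable fun w : ((Fin n × Fin d) → ℝ) × ((Fin c × Fin n) → ℝ) =>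
      projRatio (W2of w.2) (outputHessian c d n w) := by
  have hW : ∀ k i, Measurable fun w : ((Fin n × Fin d) → ℝ) × ((Fin c × Fin n) → ℝ) =>
      W2of w.2 k i := fun k i => (measurable_pi_apply (k, i)).comp measurable_snd
  unfold projRatio frob2
  refine Measurable.div ?_ ?_
  · simp only [Matrix.mul_apply, Matrix.transpose_apply]
    refine Finset.measurable_sum _ fun i _ => Finset.measurable_sum _ fun j _ =>
      Measurable.pow_const (Finset.measurable_sum _ fun k _ => Measurable.mul
        (Finset.measurable_sum _ fun l _ => (hW _ _).mul (measurable_outputHessian _ _ _))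
        (hW _ _)) 2
  · exact Finset.measurable_sum _ fun i _ => Finset.measurable_sum _ fun j _ =>
      (measurable_outputHessian d i j).pow_const 2

/-- The limit in probability as the input dimension tends to infinity. -/
lemma tendsto_weightMeasure (hc : 2 ≤ c) (hn : 0 < n) {ε : ℝ} (hε : 0 < ε) :
    Tendsto (fun d => weightMeasure c d n
      {w | ε < |projRatio (W2of w.2) (outputHessian c d n w) - 1|}) atTop
      (nhds (scaledGaussian c n {w | ε < |projRatio (W2of w) (limHess (W2of w)) - 1|})) := by
  have hS : ∀ d, MeasurableSet {w : ((Fin n × Fin d) → ℝ) × ((Fin c × Fin n) → ℝ) |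
      ε < |projRatio (W2of w.2) (outputHessian c d n w) - 1|} := fun d =>
    measurableSet_lt measurable_const ((measurable_projRatio_outputHessian d).sub_const 1).abs
  have hS' : MeasurableSet {w : (Fin c × Fin n) → ℝ |
      ε < |projRatio (W2of w) (limHess (W2of w)) - 1|} :=
    measurableSet_lt measurable_const (measurable_projRatio_limHess.sub_const 1).abs
  have he : ∀ d, weightMeasure c d n
      {w | ε < |projRatio (W2of w.2) (outputHessian c d n w) - 1|} =
      ∫⁻ w2, scaledGaussian n d
        {w1 | ε < |projRatio (W2of w2) (outputHessian c d n (w1, w2)) - 1|}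
        ∂(scaledGaussian c n) := fun d =>
    Measure.prod_apply_symm (μ := scaledGaussian n d) (ν := scaledGaussian c n) (hS d)
  simp only [he]
  rw [← lintegral_indicator_one hS']
  refine tendsto_lintegral_of_dominated_convergence (fun _ => 1)
    (fun d => measurable_measure_prodMk_right (μ := scaledGaussian n d) (hS d))
    (fun d => ae_of_all _ fun _ => prob_le_one) (by simp) ?_
  have h3 : ∀ᵐ w ∂(scaledGaussian c n), 0 < 1 - ε →
      projRatio (W2of w) (limHess (W2of w)) ≠ 1 - ε := by
    by_cases h : 0 < 1 - ε
    · filter_upwards [ae_projRatio_limHess_ne (c := c) hn h] with w hw _ using hw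
    · exact ae_of_all _ fun w h' => absurd h' h
  filter_upwards [ae_limHess_ne_zero hc hn,
    ae_projRatio_limHess_ne (c := c) hn (show 0 < 1 + ε by linarith), h3] with w hw1 hw2 hw3
  exact tendsto_measure_outputHessian w hw1 hw2 hw3

end InnerLimit

section InputMoments

variable {n : ℕ}

lemma memLp_inputMeasure_relu (i : Fin n) :
    MemLp (fun u : Fin n → ℝ => max (u i) 0) 2 (inputMeasure n) := by
  have h : MemLp (fun u : Fin n → ℝ => u i) 2 (inputMeasure n) := by
    have h2 := (memLp_id_gaussianReal (μ := 0) (v := 1) 2).comp_measurePreserving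
      (measurePreserving_eval (fun _ : Fin n => gaussianReal 0 1) i)
    exact h2
  refine h.mono ((measurable_pi_apply i).max measurable_const).aestronglyMeasurable
    (ae_of_all _ fun u => ?_)
  rw [Real.norm_eq_abs, Real.norm_eq_abs, abs_of_nonneg (le_max_right _ _)]
  exact max_le (le_abs_self _) (abs_nonneg _)

lemma integral_relu_sq_le (i : Fin n) :
    ∫ u, max (u i) 0 ^ 2 ∂(inputMeasure n) ≤ 1 := by
  have h1 : ∫ u : Fin n → ℝ, u i ^ 2 ∂(inputMeasure n) = 1 := by
    have h := variance_fun_id_gaussianReal (μ := 0) (v := 1)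
    rw [variance_eq_integral (by fun_prop), integral_id_gaussianReal] at h
    rw [← (measurePreserving_eval (fun _ : Fin n => gaussianReal 0 1) i).map_eq,
      integral_map (measurable_pi_apply i).aemeasurable (by fun_prop)] at h
    simpa [inputMeasure] using h
  rw [← h1]
  refine integral_mono_of_nonneg (ae_of_all _ fun u => by positivity) ?_
    (ae_of_all _ fun u => ?_)
  · by_contra h
    rw [integral_undef h] at h1
    exact zero_ne_one h1
  · simp only
    rcases max_cases (u i) 0 with h | h <;> rw [h.1]
    simp only [ne_eq, OfNat.ofNat_ne_zero, not_false_eq_true, zero_pow]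
    positivity

lemma integrable_relu (i : Fin n) :
    Integrable (fun u : Fin n → ℝ => max (u i) 0) (inputMeasure n) :=
  (memLp_inputMeasure_relu i).integrable (by simp)

lemma integral_relu_le (i : Fin n) : ∫ u, max (u i) 0 ∂(inputMeasure n) ≤ 1 := by
  have hi := (memLp_inputMeasure_relu i).integrable_sq
  have h : ∫ u, max (u i) 0 ∂(inputMeasure n) ≤
      ∫ u, (1 + max (u i) 0 ^ 2) / 2 ∂(inputMeasure n) := by
    refine integral_mono (integrable_relu i) (((integrable_const _).add hi).div_const 2)
      fun u => ?_
    simp only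
    nlinarith [sq_nonneg (max (u i) 0 - 1)]
  rw [integral_div, integral_add (integrable_const _) hi] at h
  have := integral_relu_sq_le i
  simp at h
  linarith

/-- Reflection of one coordinate. -/
def flipCoord (i : Fin n) (u : Fin n → ℝ) : Fin n → ℝ := fun j => if j = i then -u j else u j

lemma measurePreserving_flipCoord (i : Fin n) :
    MeasurePreserving (flipCoord i) (inputMeasure n) (inputMeasure n) := by
  refine measurePreserving_pi (fun _ : Fin n => gaussianReal 0 1) (fun _ => gaussianReal 0 1)
    (f := fun j x => if j = i then -x else x) fun j => ?_
  by_cases h : j = i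
  · simp only [h, if_true]
    exact ⟨by fun_prop, by rw [gaussianReal_map_neg, neg_zero]⟩
  · simp only [h, if_false]
    exact MeasurePreserving.id _

lemma integral_ite_mul_of_flipCoord {F : (Fin n → ℝ) → ℝ} (hF : Integrable F (inputMeasure n))
    (i : Fin n) (h : ∀ u, F (flipCoord i u) = F u) :
    ∫ u, (if 0 ≤ u i then (1 : ℝ) else 0) * F u ∂(inputMeasure n) =
      (∫ u, F u ∂(inputMeasure n)) / 2 := by
  have hm : ∀ {g : (Fin n → ℝ) → ℝ}, Measurable g → Integrable (fun u =>
      (if 0 ≤ g u then (1 : ℝ) else 0) * F u) (inputMeasure n) := by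
    intro g hg
    refine hF.bdd_mul (c := 1) (Measurable.ite (measurableSet_le measurable_const hg)
      measurable_const measurable_const).aestronglyMeasurable (ae_of_all _ fun u => ?_)
    split_ifs <;> simp
  have h1 := hm (measurable_pi_apply i)
  have h2 : Integrable (fun u => (if 0 ≤ -u i then (1 : ℝ) else 0) * F u) (inputMeasure n) :=
    hm (g := fun u => -u i) (by fun_prop)
  have h3 : ∫ u, (if 0 ≤ u i then (1 : ℝ) else 0) * F u ∂(inputMeasure n) =
      ∫ u, (if 0 ≤ -u i then (1 : ℝ) else 0) * F u ∂(inputMeasure n) := by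
    have h4 := integral_map (μ := inputMeasure n) (f := fun u =>
      (if 0 ≤ u i then (1 : ℝ) else 0) * F u) (measurePreserving_flipCoord i).aemeasurable
      (by rw [(measurePreserving_flipCoord i).map_eq]; exact h1.aestronglyMeasurable)
    rw [(measurePreserving_flipCoord i).map_eq] at h4
    rw [h4]
    simp only [h, flipCoord, if_true]
  have h5 : ∫ u, (if 0 ≤ u i then (1 : ℝ) else 0) * F u ∂(inputMeasure n) +
      ∫ u, (if 0 ≤ -u i then (1 : ℝ) else 0) * F u ∂(inputMeasure n) =
      ∫ u, F u ∂(inputMeasure n) := by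
    rw [← integral_add h1 h2]
    refine integral_congr_ae ?_
    filter_upwards [ae_inputMeasure_ne_zero n] with u hu
    rcases lt_or_gt_of_ne (hu i) with h6 | h6
    · simp [h6.le, not_le.2 h6]
    · simp [h6.le, not_le.2 h6]
  linarith

end InputMoments

section Approximation

variable {c n : ℕ}

/-- The expectation of `A` for i.i.d. standard Gaussian pre-activations. -/
noncomputable def meanAmat (W : Matrix (Fin c) (Fin n) ℝ) : Matrix (Fin c) (Fin c) ℝ :=
  Matrix.of fun k l => ∫ u, Amat (W *ᵥ fun i => max (u i) 0) k l ∂(inputMeasure n)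

lemma continuous_Amat_mulVec (W : Matrix (Fin c) (Fin n) ℝ) {g : (Fin n → ℝ) → Fin n → ℝ}
    (hg : Continuous g) (k l : Fin c) : Continuous fun u => Amat (W *ᵥ g u) k l :=
  (continuous_apply l).comp ((continuous_apply k).comp
    (continuous_Amat.comp (by fun_prop : Continuous fun u => W *ᵥ g u)))

lemma integrable_Amat_mulVec (W : Matrix (Fin c) (Fin n) ℝ) {g : (Fin n → ℝ) → Fin n → ℝ}
    (hg : Continuous g) (k l : Fin c) :
    Integrable (fun u => Amat (W *ᵥ g u) k l) (inputMeasure n) :=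
  Integrable.of_bound (continuous_Amat_mulVec W hg k l).aestronglyMeasurable 1
    (ae_of_all _ fun _ => abs_Amat_le_one _ k l)

lemma integrable_sum_Amat (W : Matrix (Fin c) (Fin n) ℝ) {g : (Fin n → ℝ) → Fin n → ℝ}
    (hg : Continuous g) (i j : Fin n) :
    Integrable (fun u => ∑ k, ∑ l, W k i * Amat (W *ᵥ g u) k l * W l j) (inputMeasure n) :=
  integrable_finsetSum _ fun k _ => integrable_finsetSum _ fun l _ =>
    ((integrable_Amat_mulVec W hg k l).const_mul _).mul_const _

lemma integral_sum_Amat (W : Matrix (Fin c) (Fin n) ℝ) (i j : Fin n) :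
    ∫ u, ∑ k, ∑ l, W k i * Amat (W *ᵥ fun i => max (u i) 0) k l * W l j ∂(inputMeasure n) =
      (Wᵀ * meanAmat W * W) i j := by
  have hg : Continuous fun (u : Fin n → ℝ) i => max (u i) 0 := by fun_prop
  have h : ∀ k l, Integrable (fun u => W k i * Amat (W *ᵥ fun i => max (u i) 0) k l * W l j)
      (inputMeasure n) := fun k l => ((integrable_Amat_mulVec W hg k l).const_mul _).mul_const _
  rw [integral_finsetSum _ fun k _ => integrable_finsetSum _ fun l _ => h k l]
  simp only [Matrix.mul_apply, Matrix.transpose_apply, Finset.sum_mul]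
  rw [Finset.sum_comm]
  refine Finset.sum_congr rfl fun k _ => ?_
  rw [integral_finsetSum _ fun l _ => h k l]
  refine Finset.sum_congr rfl fun l _ => ?_
  rw [integral_mul_const, integral_const_mul]
  rfl

lemma abs_limHess_sub_le_of_ne (W : Matrix (Fin c) (Fin n) ℝ) {i j : Fin n} (hij : i ≠ j) :
    |limHess W i j - (1 / 4 : ℝ) * (Wᵀ * meanAmat W * W) i j| ≤
      8 * ((∑ k, |W k i|) * (∑ k, |W k j|) * ((∑ k, |W k i|) + ∑ k, |W k j|)) := by
  set ai := ∑ k, |W k i| with hai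
  set aj := ∑ k, |W k j| with haj
  have hai0 : 0 ≤ ai := Finset.sum_nonneg fun _ _ => abs_nonneg _
  have haj0 : 0 ≤ aj := Finset.sum_nonneg fun _ _ => abs_nonneg _
  set D : Fin n → (Fin n → ℝ) → ℝ := fun i u => if 0 ≤ u i then (1 : ℝ) else 0 with hD
  set g : (Fin n → ℝ) → Fin n → ℝ := fun u i => max (u i) 0 with hgdef
  set g' : (Fin n → ℝ) → Fin n → ℝ := fun u r => if r = i ∨ r = j then 0 else max (u r) 0
    with hg'def
  have hg : Continuous g := by fun_prop
  have hg' : Continuous g' := by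
    refine continuous_pi fun r => ?_
    by_cases h : r = i ∨ r = j
    · simp only [hg'def, h, if_true]; fun_prop
    · simp only [hg'def, h, if_false]; fun_prop
  set Q : (Fin n → ℝ) → ℝ := fun u => ∑ k, ∑ l, W k i * Amat (W *ᵥ g u) k l * W l j with hQ
  set Q' : (Fin n → ℝ) → ℝ := fun u => ∑ k, ∑ l, W k i * Amat (W *ᵥ g' u) k l * W l j with hQ'
  have hQi : Integrable Q (inputMeasure n) := integrable_sum_Amat W hg i j
  have hQ'i : Integrable Q' (inputMeasure n) := integrable_sum_Amat W hg' i j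
  have hDm : ∀ r, Measurable (D r) := fun r =>
    Measurable.ite (measurableSet_le measurable_const (measurable_pi_apply r))
      measurable_const measurable_const
  have hDb : ∀ r u, |D r u| ≤ 1 := fun r u => by simp only [hD]; split_ifs <;> simp
  have hDi : ∀ {f : (Fin n → ℝ) → ℝ} (r), Integrable f (inputMeasure n) →
      Integrable (fun u => D r u * f u) (inputMeasure n) := fun r hf =>
    hf.bdd_mul (c := 1) (hDm r).aestronglyMeasurable (ae_of_all _ (hDb r))
  have hz : ∀ u m, (W *ᵥ g u) m - (W *ᵥ g' u) m = W m i * g u i + W m j * g u j := by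
    intro u m
    rw [← Pi.sub_apply, ← Matrix.mulVec_sub, Matrix.mulVec, dotProduct]
    rw [← Finset.sum_subset (Finset.subset_univ {i, j})]
    · rw [Finset.sum_pair hij]
      simp [hgdef, hg'def]
    · intro r _ hr
      simp only [Finset.mem_insert, Finset.mem_singleton] at hr
      simp [hgdef, hg'def, hr]
  have hzb : ∀ u, ∑ m, |(W *ᵥ g u) m - (W *ᵥ g' u) m| ≤ ai * g u i + aj * g u j := by
    intro u
    rw [hai, haj, Finset.sum_mul, Finset.sum_mul, ← Finset.sum_add_distrib]
    refine Finset.sum_le_sum fun m _ => ?_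
    rw [hz]
    refine (abs_add_le _ _).trans (le_of_eq ?_)
    rw [abs_mul, abs_mul, abs_of_nonneg (le_max_right (u i) 0),
      abs_of_nonneg (le_max_right (u j) 0)]
  have hdiff : ∀ u, |Q u - Q' u| ≤ 6 * (ai * g u i + aj * g u j) * (ai * aj) := by
    intro u
    have : Q u - Q' u = ∑ k, ∑ l, W k i *
        (Amat (W *ᵥ g u) k l - Amat (W *ᵥ g' u) k l) * W l j := by
      simp only [hQ, hQ', ← Finset.sum_sub_distrib]
      exact Finset.sum_congr rfl fun k _ => Finset.sum_congr rfl fun l _ => by ring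
    rw [this]
    refine abs_sum_mul_le (fun k l => ?_) W i j
    refine (abs_Amat_sub_le _ _ k l).trans ?_
    linarith [hzb u]
  set b : (Fin n → ℝ) → ℝ := fun u => 6 * (ai * g u i + aj * g u j) * (ai * aj) with hb
  have hbi : Integrable b (inputMeasure n) :=
    ((((integrable_relu i).const_mul ai).add ((integrable_relu j).const_mul aj)).const_mul
      6).mul_const _
  have hbI : ∫ u, b u ∂(inputMeasure n) ≤ 6 * (ai + aj) * (ai * aj) := by
    simp only [hb]
    rw [integral_mul_const, integral_const_mul, integral_add ((integrable_relu i).const_mul ai)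
      ((integrable_relu j).const_mul aj), integral_const_mul, integral_const_mul]
    have h1 := mul_le_mul_of_nonneg_left (integral_relu_le i) hai0
    have h2 := mul_le_mul_of_nonneg_left (integral_relu_le j) haj0
    exact mul_le_mul_of_nonneg_right (by linarith) (mul_nonneg hai0 haj0)
  have hflip : ∀ r, r = i ∨ r = j → ∀ u, Q' (flipCoord r u) = Q' u := by
    intro r hr u
    have : g' (flipCoord r u) = g' u := by
      ext s
      simp only [hg'def, flipCoord]
      by_cases hs : s = i ∨ s = j
      · simp [hs]
      · have : s ≠ r := by rintro rfl; exact hs hr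
        simp [hs, this]
    simp only [hQ', this]
  have hquarter : ∫ u, D i u * (D j u * Q' u) ∂(inputMeasure n) =
      (1 / 4 : ℝ) * ∫ u, Q' u ∂(inputMeasure n) := by
    have h1 := integral_ite_mul_of_flipCoord (hDi j hQ'i) i (by
      intro u
      have : D j (flipCoord i u) = D j u := by simp [hD, flipCoord, hij.symm]
      rw [this, hflip i (Or.inl rfl)])
    have h2 := integral_ite_mul_of_flipCoord hQ'i j (hflip j (Or.inr rfl))
    simp only [hD] at h1 h2 ⊢
    rw [h1, h2]
    ring
  have hL : limHess W i j = ∫ u, D i u * (D j u * Q u) ∂(inputMeasure n) := by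
    simp only [limHess, Matrix.of_apply, hessAct_apply, mul_assoc, hD, hQ, hgdef]
  have hN : (Wᵀ * meanAmat W * W) i j = ∫ u, Q u ∂(inputMeasure n) :=
    (integral_sum_Amat W i j).symm
  have e1 : |∫ u, D i u * (D j u * Q u) ∂(inputMeasure n) -
      ∫ u, D i u * (D j u * Q' u) ∂(inputMeasure n)| ≤ ∫ u, b u ∂(inputMeasure n) := by
    rw [← integral_sub (hDi i (hDi j hQi)) (hDi i (hDi j hQ'i))]
    refine norm_integral_le_of_norm_le (f := fun u => D i u * (D j u * Q u) -
      D i u * (D j u * Q' u)) hbi (ae_of_all _ fun u => ?_)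
    rw [Real.norm_eq_abs, ← mul_sub, ← mul_sub, abs_mul, abs_mul]
    refine le_trans ?_ (hdiff u)
    have := mul_le_of_le_one_left (abs_nonneg (Q u - Q' u)) (hDb j u)
    exact (mul_le_of_le_one_left (by positivity) (hDb i u)).trans this
  have e2 : |∫ u, Q u ∂(inputMeasure n) - ∫ u, Q' u ∂(inputMeasure n)| ≤
      ∫ u, b u ∂(inputMeasure n) := by
    rw [← integral_sub hQi hQ'i]
    exact norm_integral_le_of_norm_le (f := fun u => Q u - Q' u) hbi (ae_of_all _ hdiff)
  rw [hL, hN]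
  rw [hquarter] at e1
  rw [abs_le] at e1 e2 ⊢
  have : 0 ≤ (ai + aj) * (ai * aj) := by positivity
  constructor <;> nlinarith

lemma abs_limHess_diag_sub_le (W : Matrix (Fin c) (Fin n) ℝ) (i : Fin n) :
    |limHess W i i - (1 / 4 : ℝ) * (Wᵀ * meanAmat W * W) i i| ≤ 2 * (∑ k, |W k i|) ^ 2 := by
  have h1 : |limHess W i i| ≤ (∑ k, |W k i|) ^ 2 := by
    rw [sq]
    have := norm_integral_le_of_norm_le_const (μ := inputMeasure n)
      (f := fun u => hessAct W u i i) (ae_of_all _ fun u => abs_hessAct_le W u i i)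
    simpa [limHess] using this
  have h2 : |(Wᵀ * meanAmat W * W) i i| ≤ (∑ k, |W k i|) ^ 2 := by
    rw [sq, ← integral_sum_Amat]
    have := norm_integral_le_of_norm_le_const (μ := inputMeasure n)
      (f := fun u => ∑ k, ∑ l, W k i * Amat (W *ᵥ fun i => max (u i) 0) k l * W l i)
      (ae_of_all _ fun u => abs_sum_mul_le (abs_Amat_le_one (W *ᵥ fun i => max (u i) 0)) W i i)
    simpa using this
  rw [abs_le] at *
  constructor <;> linarith [h1.1, h1.2, h2.1, h2.2]

lemma frob2_limHess_sub_le (W : Matrix (Fin c) (Fin n) ℝ) :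
    frob2 (limHess W - (1 / 4 : ℝ) • (Wᵀ * meanAmat W * W)) ≤
      256 * ((∑ i, (∑ k, |W k i|) ^ 4) * (1 + ∑ i, (∑ k, |W k i|) ^ 2)) := by
  set a : Fin n → ℝ := fun i => ∑ k, |W k i| with ha
  have ha0 : ∀ i, 0 ≤ a i := fun i => Finset.sum_nonneg fun _ _ => abs_nonneg _
  have hE : ∀ i j, (limHess W - (1 / 4 : ℝ) • (Wᵀ * meanAmat W * W)) i j ^ 2 ≤
      128 * (a i ^ 4 * a j ^ 2 + a i ^ 2 * a j ^ 4) + if i = j then 4 * a i ^ 4 else 0 := by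
    intro i j
    rw [Matrix.sub_apply, Matrix.smul_apply, smul_eq_mul]
    have hi := ha0 i
    have hj := ha0 j
    split_ifs with h
    · subst h
      have h1 := pow_le_pow_left₀ (abs_nonneg _) (abs_limHess_diag_sub_le W i) 2
      rw [sq_abs] at h1
      have : 0 ≤ 128 * (a i ^ 4 * a i ^ 2 + a i ^ 2 * a i ^ 4) := by positivity
      have h2 : (2 * a i ^ 2) ^ 2 = 4 * a i ^ 4 := by ring
      linarith
    · have h1 := pow_le_pow_left₀ (abs_nonneg _) (abs_limHess_sub_le_of_ne W h) 2
      rw [sq_abs] at h1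
      refine h1.trans ?_
      change (8 * (a i * a j * (a i + a j))) ^ 2 ≤ _
      have h2 : 0 ≤ 64 * ((a i * a j) ^ 2 * (a i - a j) ^ 2) := by positivity
      nlinarith
  refine (Finset.sum_le_sum fun i _ => Finset.sum_le_sum fun j _ => hE i j).trans ?_
  have h3 : ∑ i, ∑ j, (128 * (a i ^ 4 * a j ^ 2 + a i ^ 2 * a j ^ 4) +
      if i = j then 4 * a i ^ 4 else 0) =
      256 * ((∑ i, a i ^ 4) * ∑ i, a i ^ 2) + 4 * ∑ i, a i ^ 4 := by
    simp only [Finset.sum_add_distrib, Finset.sum_ite_eq, Finset.mem_univ, if_true,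
      ← Finset.mul_sum, ← Finset.sum_mul]
    ring
  rw [h3]
  have : 0 ≤ ∑ i, a i ^ 4 := Finset.sum_nonneg fun i _ => by positivity
  linarith

end Approximation

section FrobeniusNorm

open scoped Matrix.Norms.Frobenius

variable {c n : ℕ}

lemma frob2_eq_norm_sq {m k : ℕ} (A : Matrix (Fin m) (Fin k) ℝ) : frob2 A = ‖A‖ ^ 2 := by
  rw [Matrix.frobenius_norm_def, ← Real.sqrt_eq_rpow, Real.sq_sqrt]
  · simp [frob2]
  · exact Finset.sum_nonneg fun _ _ => Finset.sum_nonneg fun _ _ => by positivity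

lemma abs_trace_transpose_mul_le {m k : ℕ} (A B : Matrix (Fin m) (Fin k) ℝ) :
    |(Aᵀ * B).trace| ≤ ‖A‖ * ‖B‖ := by
  refine abs_le_of_sq_le_sq ?_ (by positivity)
  rw [mul_pow, ← frob2_eq_norm_sq, ← frob2_eq_norm_sq]
  have h : (Aᵀ * B).trace = ∑ p : Fin k × Fin m, A p.2 p.1 * B p.2 p.1 := by
    simp only [Matrix.trace, Matrix.diag, Matrix.mul_apply, Matrix.transpose_apply,
      Fintype.sum_prod_type]
  rw [h, ← frob2_transpose A, ← frob2_transpose B]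
  refine (Finset.sum_mul_sq_le_sq_mul_sq _ _ _).trans (le_of_eq ?_)
  simp only [frob2, Fintype.sum_prod_type, Matrix.transpose_apply]

lemma frob2_eq_trace {m k : ℕ} (A : Matrix (Fin m) (Fin k) ℝ) : frob2 A = (Aᵀ * A).trace := by
  rw [← frob2_transpose]
  simp only [frob2, Matrix.trace, Matrix.diag, Matrix.mul_apply, Matrix.transpose_apply, sq]

lemma frob2_transpose_conj (W : Matrix (Fin c) (Fin n) ℝ) (A : Matrix (Fin c) (Fin c) ℝ) :
    frob2 (Wᵀ * A * W) = (Aᵀ * ((W * Wᵀ) * A * (W * Wᵀ))).trace := by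
  rw [frob2_eq_trace]
  simp only [Matrix.transpose_mul, Matrix.transpose_transpose, Matrix.mul_assoc]
  rw [Matrix.trace_mul_comm]
  simp only [Matrix.mul_assoc]

lemma norm_conj_sub_le {S A : Matrix (Fin c) (Fin c) ℝ} {τ : ℝ} (hS : ‖S - 1‖ ≤ τ) (hτ : τ ≤ 1) :
    ‖S * A * S - A‖ ≤ 3 * τ * ‖A‖ := by
  set T := S - 1 with hT
  have h : S * A * S - A = T * A + A * T + T * A * T := by
    rw [hT]; noncomm_ring
  have hτ0 : 0 ≤ τ := (norm_nonneg _).trans hS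
  have h1 : ‖T * A‖ ≤ τ * ‖A‖ := (Matrix.frobenius_norm_mul _ _).trans (by gcongr)
  have h2 : ‖A * T‖ ≤ ‖A‖ * τ := (Matrix.frobenius_norm_mul _ _).trans (by gcongr)
  have h3 : ‖T * A * T‖ ≤ τ * ‖A‖ * τ := (Matrix.frobenius_norm_mul _ _).trans (by gcongr)
  have h4 : τ * ‖A‖ * τ ≤ τ * ‖A‖ := mul_le_of_le_one_right (by positivity) hτ
  rw [h]
  linarith [norm_add_le (T * A + A * T) (T * A * T), norm_add_le (T * A) (A * T)]

lemma abs_sq_div_sq_sub_one_le {x y b θ : ℝ} (hb : 0 < b) (hθ0 : 0 ≤ θ) (hθ : θ ≤ 1 / 2)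
    (hx1 : (1 - θ) * b ≤ x) (hx2 : x ≤ (1 + θ) * b) (hy1 : (1 - θ) * b ≤ y)
    (hy2 : y ≤ (1 + θ) * b) : |y ^ 2 / x ^ 2 - 1| ≤ 16 * θ := by
  have hl : 0 < (1 - θ) * b := mul_pos (by linarith) hb
  have hx : 0 < x := hl.trans_le hx1
  have h1 : y ^ 2 ≤ ((1 + θ) * b) ^ 2 := pow_le_pow_left₀ (hl.le.trans hy1) hy2 2
  have h2 : ((1 - θ) * b) ^ 2 ≤ y ^ 2 := pow_le_pow_left₀ hl.le hy1 2
  have h3 : x ^ 2 ≤ ((1 + θ) * b) ^ 2 := pow_le_pow_left₀ hx.le hx2 2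
  have h4 : ((1 - θ) * b) ^ 2 ≤ x ^ 2 := pow_le_pow_left₀ hl.le hx1 2
  have h5 : b ^ 2 ≤ 4 * x ^ 2 := by
    have := pow_le_pow_left₀ hb.le (by nlinarith : b ≤ 2 * x) 2
    linarith
  have h6 : ((1 + θ) * b) ^ 2 - ((1 - θ) * b) ^ 2 = 4 * θ * b ^ 2 := by ring
  have h7 : 4 * θ * b ^ 2 ≤ 16 * θ * x ^ 2 := by nlinarith
  rw [div_sub_one (by positivity), abs_div, abs_of_pos (by positivity : 0 < x ^ 2),
    div_le_iff₀ (by positivity), abs_le]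
  constructor <;> linarith

lemma abs_projRatio_sub_one_le {W : Matrix (Fin c) (Fin n) ℝ} {A : Matrix (Fin c) (Fin c) ℝ}
    {M : Matrix (Fin n) (Fin n) ℝ} {τ ρ B θ : ℝ} (hA : A ≠ 0)
    (hS : ‖W * Wᵀ - 1‖ ≤ τ) (hE : ‖M - (1 / 4 : ℝ) • (Wᵀ * A * W)‖ ≤ ρ * ‖A‖)
    (hW : frob2 W ≤ B) (hB : 1 ≤ B) (hθ1 : 3 * τ + 4 * B * ρ ≤ θ) (hθ : θ ≤ 1 / 2) :
    |projRatio W M - 1| ≤ 16 * θ := by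
  have ha : 0 < ‖A‖ := norm_pos_iff.2 hA
  have hτ0 : 0 ≤ τ := (norm_nonneg _).trans hS
  have hρ0 : 0 ≤ ρ := by
    by_contra h
    have := mul_neg_of_neg_of_pos (not_le.1 h) ha
    linarith [norm_nonneg (M - (1 / 4 : ℝ) • (Wᵀ * A * W))]
  have hBρ : ρ ≤ B * ρ := le_mul_of_one_le_left hρ0 hB
  have hτ1 : τ ≤ 1 := by nlinarith
  set N := Wᵀ * A * W with hN
  set E := M - (1 / 4 : ℝ) • N with hEdef
  set S := W * Wᵀ with hSdef
  have hM : M = (1 / 4 : ℝ) • N + E := by rw [hEdef]; abel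
  have hSA := norm_conj_sub_le (A := A) hS hτ1
  have hNsq : |‖N‖ ^ 2 - ‖A‖ ^ 2| ≤ 3 * τ * ‖A‖ ^ 2 := by
    rw [← frob2_eq_norm_sq, ← frob2_eq_norm_sq, hN, frob2_transpose_conj, frob2_eq_trace A,
      ← Matrix.trace_sub, ← Matrix.mul_sub]
    refine (abs_trace_transpose_mul_le _ _).trans ?_
    have := mul_le_mul_of_nonneg_left hSA ha.le
    rw [← frob2_eq_trace, frob2_eq_norm_sq]
    linarith
  rw [abs_le] at hNsq
  have hN1 : (1 - 3 * τ) * ‖A‖ ≤ ‖N‖ := by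
    refine (pow_le_pow_iff_left₀ (mul_nonneg (by nlinarith) ha.le) (norm_nonneg _) two_ne_zero).1 ?_
    have h : (1 - 3 * τ) ^ 2 ≤ 1 - 3 * τ := by nlinarith
    nlinarith [mul_le_mul_of_nonneg_right h (sq_nonneg ‖A‖)]
  have hN2 : ‖N‖ ≤ (1 + 3 * τ) * ‖A‖ := by
    refine (pow_le_pow_iff_left₀ (norm_nonneg _) (by positivity) two_ne_zero).1 ?_
    have h : 1 + 3 * τ ≤ (1 + 3 * τ) ^ 2 := by nlinarith
    nlinarith [mul_le_mul_of_nonneg_right h (sq_nonneg ‖A‖)]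
  have hM1 : |‖M‖ - ‖N‖ / 4| ≤ ρ * ‖A‖ := by
    have h := abs_norm_sub_norm_le M ((1 / 4 : ℝ) • N)
    rw [norm_smul, Real.norm_of_nonneg (by norm_num)] at h
    refine le_trans (le_of_eq ?_) (h.trans hE)
    congr 1; ring
  have hWMW : W * M * Wᵀ - (1 / 4 : ℝ) • (S * A * S) = W * E * Wᵀ := by
    rw [hM, hN, hSdef]
    simp only [Matrix.mul_add, Matrix.add_mul, Matrix.mul_smul, Matrix.smul_mul, Matrix.mul_assoc]
    abel
  have hWE : ‖W * E * Wᵀ‖ ≤ B * (ρ * ‖A‖) := by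
    have h1 := (Matrix.frobenius_norm_mul (W * E) Wᵀ).trans
      (mul_le_mul_of_nonneg_right (Matrix.frobenius_norm_mul W E) (norm_nonneg _))
    have h2 : ‖Wᵀ‖ = ‖W‖ := Matrix.frobenius_norm_transpose W
    rw [h2] at h1
    rw [frob2_eq_norm_sq] at hW
    calc ‖W * E * Wᵀ‖ ≤ ‖W‖ ^ 2 * ‖E‖ := by linarith
      _ ≤ B * (ρ * ‖A‖) := by gcongr
  have hY1 : |‖W * M * Wᵀ‖ - ‖S * A * S‖ / 4| ≤ B * (ρ * ‖A‖) := by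
    have h := abs_norm_sub_norm_le (W * M * Wᵀ) ((1 / 4 : ℝ) • (S * A * S))
    rw [norm_smul, Real.norm_of_nonneg (by norm_num), hWMW] at h
    refine le_trans (le_of_eq ?_) (h.trans hWE)
    congr 1; ring
  have hS2 := (abs_norm_sub_norm_le (S * A * S) A).trans hSA
  rw [abs_le] at hM1 hY1 hS2
  have hB2 := mul_le_mul_of_nonneg_right hBρ ha.le
  have hθ2 := mul_le_mul_of_nonneg_right hθ1 ha.le
  rw [projRatio, frob2_eq_norm_sq, frob2_eq_norm_sq]
  refine abs_sq_div_sq_sub_one_le (b := ‖A‖ / 4) (by positivity) (by nlinarith) hθ ?_ ?_ ?_ ?_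
  all_goals nlinarith

end FrobeniusNorm

section MeanLowerBound

variable {c n : ℕ}

/-- The mean squared norm of the logits for i.i.d. standard Gaussian pre-activations. -/
noncomputable def logitEnergy (W : Matrix (Fin c) (Fin n) ℝ) : ℝ :=
  ∫ u, ∑ m, (W *ᵥ fun i => max (u i) 0) m ^ 2 ∂(inputMeasure n)

lemma integrable_relu_mul (i j : Fin n) :
    Integrable (fun u : Fin n → ℝ => max (u i) 0 * max (u j) 0) (inputMeasure n) :=
  (memLp_inputMeasure_relu i).integrable_mul (memLp_inputMeasure_relu j)

lemma sum_mulVec_sq (W : Matrix (Fin c) (Fin n) ℝ) (y : Fin n → ℝ) :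
    ∑ m, (W *ᵥ y) m ^ 2 = ∑ m, ∑ i, ∑ j, (W m i * W m j) * (y i * y j) := by
  refine Finset.sum_congr rfl fun m _ => ?_
  rw [sq, Matrix.mulVec, dotProduct, Finset.sum_mul_sum]
  exact Finset.sum_congr rfl fun i _ => Finset.sum_congr rfl fun j _ => by ring

lemma integrable_sum_mulVec_relu_sq (W : Matrix (Fin c) (Fin n) ℝ) :
    Integrable (fun u => ∑ m, (W *ᵥ fun i => max (u i) 0) m ^ 2) (inputMeasure n) := by
  simp only [sum_mulVec_sq]
  exact integrable_finsetSum _ fun m _ => integrable_finsetSum _ fun i _ =>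
    integrable_finsetSum _ fun j _ => (integrable_relu_mul i j).const_mul _

lemma logitEnergy_eq (W : Matrix (Fin c) (Fin n) ℝ) :
    logitEnergy W = ∑ m, ∑ i, ∑ j,
      (W m i * W m j) * ∫ u, max (u i) 0 * max (u j) 0 ∂(inputMeasure n) := by
  have h := fun (m : Fin c) (i j : Fin n) => (integrable_relu_mul i j).const_mul (W m i * W m j)
  simp only [logitEnergy, sum_mulVec_sq]
  rw [integral_finsetSum _ fun m _ => integrable_finsetSum _ fun i _ =>
    integrable_finsetSum _ fun j _ => h m i j]
  refine Finset.sum_congr rfl fun m _ => ?_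
  rw [integral_finsetSum _ fun i _ => integrable_finsetSum _ fun j _ => h m i j]
  refine Finset.sum_congr rfl fun i _ => ?_
  rw [integral_finsetSum _ fun j _ => h m i j]
  exact Finset.sum_congr rfl fun j _ => integral_const_mul _ _

lemma logitEnergy_nonneg (W : Matrix (Fin c) (Fin n) ℝ) : 0 ≤ logitEnergy W :=
  integral_nonneg fun _ => Finset.sum_nonneg fun _ _ => sq_nonneg _

lemma integrable_logitEnergy :
    Integrable (fun w => logitEnergy (W2of w)) (scaledGaussian c n) := by
  simp only [logitEnergy_eq, W2of, Matrix.of_apply]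
  exact integrable_finsetSum _ fun m _ => integrable_finsetSum _ fun i _ =>
    integrable_finsetSum _ fun j _ =>
      ((memLp_scaledGaussian_mul _ _).integrable (by simp)).mul_const _

lemma integral_logitEnergy_le :
    ∫ w, logitEnergy (W2of w) ∂(scaledGaussian c n) ≤ c := by
  have h := fun (m : Fin c) (i j : Fin n) =>
    ((memLp_scaledGaussian_mul (m, i) (m, j)).integrable (by simp)).mul_const
      (∫ u, max (u i) 0 * max (u j) 0 ∂(inputMeasure n))
  simp only [logitEnergy_eq, W2of, Matrix.of_apply]
  rw [integral_finsetSum _ fun m _ => integrable_finsetSum _ fun i _ =>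
    integrable_finsetSum _ fun j _ => h m i j]
  have hm : ∀ m : Fin c, ∫ w, ∑ i, ∑ j, (w (m, i) * w (m, j)) *
      ∫ u, max (u i) 0 * max (u j) 0 ∂(inputMeasure n) ∂(scaledGaussian c n) ≤ 1 := by
    intro m
    rw [integral_finsetSum _ fun i _ => integrable_finsetSum _ fun j _ => h m i j]
    have hi : ∀ i : Fin n, ∫ w, ∑ j, (w (m, i) * w (m, j)) *
        ∫ u, max (u i) 0 * max (u j) 0 ∂(inputMeasure n) ∂(scaledGaussian c n) ≤ (n : ℝ)⁻¹ := by
      intro i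
      rw [integral_finsetSum _ fun j _ => h m i j]
      simp only [integral_mul_const, integral_scaledGaussian_mul, Prod.mk.injEq, true_and,
        ite_mul, zero_mul]
      rw [Finset.sum_ite_eq Finset.univ i]
      simp only [Finset.mem_univ, if_true, ← sq]
      exact mul_le_of_le_one_right (by positivity) (integral_relu_sq_le i)
    refine (Finset.sum_le_sum fun i _ => hi i).trans ?_
    simp only [Finset.sum_const, Finset.card_univ, Fintype.card_fin, nsmul_eq_mul]
    exact mul_inv_le_one
  refine (Finset.sum_le_sum fun m _ => hm m).trans ?_
  simp

lemma measure_logitEnergy_ge_le {K : ℝ} (hK : 0 < K) :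
    scaledGaussian c n {w | K ≤ logitEnergy (W2of w)} ≤ ENNReal.ofReal (c / K) := by
  have h := (mul_meas_ge_le_integral_of_nonneg (μ := scaledGaussian c n)
    (ae_of_all _ fun w => logitEnergy_nonneg (W2of w)) integrable_logitEnergy K).trans
    integral_logitEnergy_le
  rw [← ofReal_measureReal]
  refine ENNReal.ofReal_le_ofReal ?_
  rw [le_div_iff₀ hK]
  linarith

lemma softmaxFn_ge (z : Fin c → ℝ) (i : Fin c) :
    (c : ℝ)⁻¹ * Real.exp (-(2 * ∑ m, |z m|)) ≤ softmaxFn z i := by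
  have hc : (0 : ℝ) < c := by exact_mod_cast i.pos
  have hle : ∀ m, |z m| ≤ ∑ m, |z m| := fun m =>
    Finset.single_le_sum (f := fun m => |z m|) (fun k _ => abs_nonneg (z k)) (Finset.mem_univ m)
  set s := ∑ m, |z m|
  have h1 : Real.exp (-s) ≤ Real.exp (z i) :=
    Real.exp_le_exp.2 (by linarith [hle i, neg_abs_le (z i)])
  have h2 : ∑ k, Real.exp (z k) ≤ c * Real.exp s := by
    refine (Finset.sum_le_sum fun k _ =>
      Real.exp_le_exp.2 ((le_abs_self (z k)).trans (hle k))).trans ?_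
    simp
  have h3 : 0 < ∑ k, Real.exp (z k) :=
    Finset.sum_pos (fun _ _ => Real.exp_pos _) ⟨i, Finset.mem_univ i⟩
  rw [softmaxFn, le_div_iff₀ h3]
  refine (mul_le_mul_of_nonneg_left h2 (by positivity)).trans (le_trans (le_of_eq ?_) h1)
  have : Real.exp (-(2 * s)) * Real.exp s = Real.exp (-s) := by
    rw [← Real.exp_add]; congr 1; ring
  rw [← this]
  field_simp

lemma Amat_diag_ge_exp (hc : 2 ≤ c) (z : Fin c → ℝ) (a : Fin c) :
    ((c : ℝ)⁻¹) ^ 2 * Real.exp (-(2 * c + 2 * ∑ m, z m ^ 2)) ≤ Amat z a a := by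
  have : Nontrivial (Fin c) := Fin.nontrivial_iff_two_le.2 hc
  obtain ⟨b, hb⟩ := exists_ne a
  refine le_trans ?_ (Amat_diag_ge z hb.symm)
  have h0 : 0 ≤ (c : ℝ)⁻¹ * Real.exp (-(2 * ∑ m, |z m|)) := by positivity
  refine le_trans ?_ (mul_le_mul (softmaxFn_ge z a) (softmaxFn_ge z b) h0 (softmaxFn_pos z a).le)
  have h1 : 4 * ∑ m, |z m| ≤ 2 * c + 2 * ∑ m, z m ^ 2 := by
    have : ∑ m, 4 * |z m| ≤ ∑ m, (2 + 2 * z m ^ 2) := Finset.sum_le_sum fun m _ => by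
      nlinarith [sq_nonneg (|z m| - 1), sq_abs (z m)]
    rw [Finset.sum_add_distrib, ← Finset.mul_sum, ← Finset.mul_sum] at this
    simp at this
    linarith
  have h2 : (c : ℝ)⁻¹ * Real.exp (-(2 * ∑ m, |z m|)) * ((c : ℝ)⁻¹ * Real.exp (-(2 * ∑ m, |z m|))) =
      ((c : ℝ)⁻¹) ^ 2 * Real.exp (-(4 * ∑ m, |z m|)) := by
    rw [show -(4 * ∑ m, |z m|) = -(2 * ∑ m, |z m|) + -(2 * ∑ m, |z m|) by ring, Real.exp_add]
    ring
  rw [h2]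
  exact mul_le_mul_of_nonneg_left (Real.exp_le_exp.2 (by linarith)) (by positivity)

lemma meanAmat_diag_ge (hc : 2 ≤ c) (W : Matrix (Fin c) (Fin n) ℝ) (a : Fin c) :
    ((c : ℝ)⁻¹) ^ 2 * Real.exp (-(2 * c + 2 * logitEnergy W)) ≤ meanAmat W a a := by
  set e := logitEnergy W with he
  have hi := integrable_sum_mulVec_relu_sq W
  have hi2 : Integrable (fun u => ((c : ℝ)⁻¹) ^ 2 * (Real.exp (-(2 * c + 2 * e)) *
      (1 + 2 * e - 2 * ∑ m, (W *ᵥ fun i => max (u i) 0) m ^ 2))) (inputMeasure n) :=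
    ((((integrable_const _).sub (hi.const_mul 2))).const_mul _).const_mul _
  have h := integral_mono hi2 (integrable_Amat_mulVec W
    (g := fun u i => max (u i) 0) (by fun_prop) a a) fun u => by
      refine le_trans (mul_le_mul_of_nonneg_left ?_ (by positivity)) (Amat_diag_ge_exp hc _ a)
      set y := ∑ m, (W *ᵥ fun i => max (u i) 0) m ^ 2
      rw [show -(2 * (c : ℝ) + 2 * y) = -(2 * c + 2 * e) + (2 * e - 2 * y) by ring, Real.exp_add]
      refine mul_le_mul_of_nonneg_left ?_ (Real.exp_pos _).le
      linarith [Real.add_one_le_exp (2 * e - 2 * y)]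
  rw [integral_const_mul, integral_const_mul, integral_sub (integrable_const _) (hi.const_mul 2),
    integral_const_mul] at h
  change _ ≤ meanAmat W a a at h
  refine le_trans (le_of_eq ?_) h
  have : ∫ u, ∑ m, (W *ᵥ fun i => max (u i) 0) m ^ 2 ∂(inputMeasure n) = e := rfl
  rw [this]
  simp

end MeanLowerBound

section Closeness

variable {c n : ℕ}

lemma frob2_eq_sum_diag (W : Matrix (Fin c) (Fin n) ℝ) : frob2 W = ∑ k, (W * Wᵀ) k k := by
  simp [frob2, Matrix.mul_apply, sq]

lemma frob2_le_of_gram {W : Matrix (Fin c) (Fin n) ℝ} {η : ℝ} (hη : η ≤ 1)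
    (h : ∀ k l, |(W * Wᵀ) k l - (1 : Matrix (Fin c) (Fin c) ℝ) k l| < η) :
    frob2 W ≤ 2 * c := by
  rw [frob2_eq_sum_diag]
  have : ∀ k, (W * Wᵀ) k k ≤ 2 := fun k => by
    have := (abs_lt.1 (h k k)).2
    rw [Matrix.one_apply_eq] at this
    linarith
  refine (Finset.sum_le_sum fun k _ => this k).trans (le_of_eq ?_)
  simp [mul_comm]

lemma sum_colSum_sq_le (W : Matrix (Fin c) (Fin n) ℝ) :
    ∑ i, (∑ k, |W k i|) ^ 2 ≤ c * frob2 W := by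
  rw [frob2, Finset.sum_comm, Finset.mul_sum]
  refine Finset.sum_le_sum fun i _ => ?_
  refine (sq_sum_le_card_mul_sum_sq (s := Finset.univ) (f := fun k => |W k i|)).trans (le_of_eq ?_)
  simp

lemma sum_colSum_pow_four_le (w : (Fin c × Fin n) → ℝ) :
    ∑ i, (∑ k, |W2of w k i|) ^ 4 ≤ c ^ 3 * ∑ p, w p ^ 4 := by
  rw [Fintype.sum_prod_type_right, Finset.mul_sum]
  refine Finset.sum_le_sum fun i _ => ?_
  have h := pow_sum_le_card_mul_sum_pow (s := Finset.univ) (f := fun k => |W2of w k i|)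
    (fun _ _ => abs_nonneg _) 3
  simpa [W2of, (by decide : Even 4).pow_abs] using h

open scoped Matrix.Norms.Frobenius in
lemma norm_sub_one_le_of_gram {S : Matrix (Fin c) (Fin c) ℝ} {η : ℝ} (hη : 0 ≤ η)
    (h : ∀ k l, |S k l - (1 : Matrix (Fin c) (Fin c) ℝ) k l| < η) : ‖S - 1‖ ≤ c * η := by
  refine (pow_le_pow_iff_left₀ (norm_nonneg _) (by positivity) two_ne_zero).1 ?_
  rw [← frob2_eq_norm_sq, frob2]
  refine (Finset.sum_le_sum fun k _ => Finset.sum_le_sum fun l _ =>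
    sq_le_sq' (neg_le_of_abs_le (h k l).le) (le_of_abs_le (h k l).le)).trans (le_of_eq ?_)
  simp
  ring

open scoped Matrix.Norms.Frobenius in
lemma exists_abs_projRatio_limHess_sub_one_le (hc : 2 ≤ c) {ε K : ℝ} (hε : 0 < ε) :
    ∃ η₁ > 0, ∃ η₂ > 0, ∀ (n : ℕ) (w : (Fin c × Fin n) → ℝ),
      (∀ k l, |(W1of w * (W1of w)ᵀ) k l - (1 : Matrix (Fin c) (Fin c) ℝ) k l| < η₁) →
      ∑ p, w p ^ 4 < η₂ → logitEnergy (W2of w) < K →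
      |projRatio (W2of w) (limHess (W2of w)) - 1| ≤ ε := by
  have hc' : (2 : ℝ) ≤ c := by exact_mod_cast hc
  have hc0 : (0 : ℝ) < c := by linarith
  set θ := min (1 / 2) (ε / 16) with hθ
  have hθ0 : 0 < θ := by positivity
  have hθ1 : θ ≤ 1 / 2 := min_le_left _ _
  have hθ2 : 16 * θ ≤ ε := by linarith [min_le_right (1 / 2) (ε / 16)]
  set a := ((c : ℝ)⁻¹) ^ 2 * Real.exp (-(2 * c + 2 * K)) with ha
  have ha0 : 0 < a := by positivity
  set ρ := θ / (16 * c) with hρ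
  have hρ0 : 0 < ρ := by positivity
  have hD : 0 < 256 * (c : ℝ) ^ 3 * (1 + 2 * c ^ 2) := by positivity
  refine ⟨min 1 (θ / 6 / c), by positivity, (ρ * a) ^ 2 / (256 * (c : ℝ) ^ 3 * (1 + 2 * c ^ 2)),
    by positivity, fun n w hG hF hK => ?_⟩
  have hW := frob2_le_of_gram (W := W2of w) (min_le_left _ _) hG
  have hA : a ≤ ‖meanAmat (W2of w)‖ := by
    let k : Fin c := ⟨0, by omega⟩
    have h1 : a ≤ meanAmat (W2of w) k k :=
      (mul_le_mul_of_nonneg_left (Real.exp_le_exp.2 (by linarith)) (by positivity)).trans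
        (meanAmat_diag_ge hc (W2of w) k)
    refine (pow_le_pow_iff_left₀ ha0.le (norm_nonneg _) two_ne_zero).1 ?_
    rw [← frob2_eq_norm_sq]
    refine (pow_le_pow_left₀ ha0.le h1 2).trans ?_
    refine le_trans ?_ (Finset.single_le_sum
      (f := fun i => ∑ j, meanAmat (W2of w) i j ^ 2)
      (fun _ _ => Finset.sum_nonneg fun _ _ => sq_nonneg _) (Finset.mem_univ k))
    exact Finset.single_le_sum (f := fun j => meanAmat (W2of w) k j ^ 2)
      (fun _ _ => sq_nonneg _) (Finset.mem_univ k)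
  have hA0 : meanAmat (W2of w) ≠ 0 := norm_pos_iff.1 (ha0.trans_le hA)
  have hS : ‖W2of w * (W2of w)ᵀ - 1‖ ≤ θ / 6 := by
    refine (norm_sub_one_le_of_gram (by positivity) hG).trans ?_
    refine (mul_le_mul_of_nonneg_left (min_le_right _ _) hc0.le).trans (le_of_eq ?_)
    field_simp
  have hE : ‖limHess (W2of w) - (1 / 4 : ℝ) • ((W2of w)ᵀ * meanAmat (W2of w) * W2of w)‖ ≤
      ρ * ‖meanAmat (W2of w)‖ := by
    refine le_trans ?_ (mul_le_mul_of_nonneg_left hA hρ0.le)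
    refine (pow_le_pow_iff_left₀ (norm_nonneg _) (by positivity) two_ne_zero).1 ?_
    rw [← frob2_eq_norm_sq]
    refine (frob2_limHess_sub_le _).trans ?_
    have h4 := sum_colSum_pow_four_le w
    have h2 : ∑ i, (∑ k, |W2of w k i|) ^ 2 ≤ 2 * c ^ 2 :=
      (sum_colSum_sq_le _).trans (by nlinarith)
    rw [lt_div_iff₀ hD] at hF
    have hF0 : 0 ≤ ∑ p, w p ^ 4 := Finset.sum_nonneg fun _ _ => by positivity
    calc 256 * ((∑ i, (∑ k, |W2of w k i|) ^ 4) * (1 + ∑ i, (∑ k, |W2of w k i|) ^ 2))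
        ≤ 256 * ((c ^ 3 * ∑ p, w p ^ 4) * (1 + 2 * c ^ 2)) := by gcongr
      _ ≤ (ρ * a) ^ 2 := by linarith
  refine (abs_projRatio_sub_one_le hA0 hS hE hW (by linarith) (θ := θ) (le_of_eq ?_) hθ1).trans hθ2
  rw [hρ]
  field_simp
  ring

end Closeness

lemma tendsto_scaledGaussian_projRatio {c : ℕ} (hc : 2 ≤ c) {ε : ℝ} (hε : 0 < ε) :
    Tendsto (fun n => scaledGaussian c n {w | ε < |projRatio (W2of w) (limHess (W2of w)) - 1|})
      atTop (nhds 0) := by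
  rw [ENNReal.tendsto_nhds_zero]
  intro δ hδ
  obtain ⟨δ', hδ'0, hδ'⟩ : ∃ δ' : ℝ, 0 < δ' ∧ ENNReal.ofReal δ' ≤ δ / 2 := by
    obtain ⟨r, hr0, hr⟩ := ENNReal.lt_iff_exists_nnreal_btwn.1 (ENNReal.half_pos hδ.ne')
    exact ⟨r, by exact_mod_cast hr0, by simpa using hr.le⟩
  have hc0 : (0 : ℝ) < c := by exact_mod_cast (by omega : 0 < c)
  have hK : 0 < c / δ' := by positivity
  obtain ⟨η₁, hη₁, η₂, hη₂, h⟩ :=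
    exists_abs_projRatio_limHess_sub_one_le (K := c / δ') hc hε
  have ht := (tendsto_measure_gram c hη₁).add (tendsto_measure_sum_pow_four c hη₂)
  rw [add_zero, ENNReal.tendsto_nhds_zero] at ht
  filter_upwards [ht _ (ENNReal.half_pos hδ.ne')] with n hn
  have hsub : {w : (Fin c × Fin n) → ℝ | ε < |projRatio (W2of w) (limHess (W2of w)) - 1|} ⊆
      ({w | ∃ k l, η₁ ≤ |(W1of w * (W1of w)ᵀ) k l - (1 : Matrix (Fin c) (Fin c) ℝ) k l|} ∪
        {w | η₂ ≤ ∑ p, w p ^ 4}) ∪ {w | c / δ' ≤ logitEnergy (W2of w)} := by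
    intro w hw
    by_contra hcon
    simp only [Set.mem_union, Set.mem_ofPred_eq, not_or, not_exists, not_le] at hcon hw
    exact (h n w hcon.1.1 hcon.1.2 hcon.2).not_gt hw
  have hle := measure_logitEnergy_ge_le (c := c) (n := n) hK
  rw [div_div_cancel₀ hc0.ne'] at hle
  calc _ ≤ _ := measure_mono hsub
    _ ≤ _ := (measure_union_le _ _).trans (add_le_add_left (measure_union_le _ _) _)
    _ ≤ δ / 2 + δ / 2 := add_le_add hn (hle.trans hδ')
    _ = δ := ENNReal.add_halves δ

lemma tendsto_weightMeasure_zero (c : ℕ) {ε : ℝ} :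
    ∃ l, Tendsto (fun d : ℕ => weightMeasure c d 0
      {w | ε < |projRatio (W2of w.2) (outputHessian c d 0 w) - 1|}) atTop (nhds l) := by
  have hp : ∀ d, IsProbabilityMeasure (weightMeasure c d 0) := fun d => by
    unfold weightMeasure; infer_instance
  have h : ∀ (W : Matrix (Fin c) (Fin 0) ℝ) (M : Matrix (Fin 0) (Fin 0) ℝ), projRatio W M = 0 :=
    fun W M => by simp [projRatio, frob2]
  simp only [h]
  by_cases hε : ε < |(0 : ℝ) - 1|
  · simp only [hε, Set.ofPred_true, measure_univ]
    exact ⟨1, tendsto_const_nhds⟩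
  · simp only [hε, Set.ofPred_false, measure_empty]
    exact ⟨0, tendsto_const_nhds⟩

/-- **Projecting the output Hessian onto the row span of `W²` preserves its Frobenius
norm.**  In the two-layer random ReLU network with Gaussian data, for every `ε > 0`,
`lim_{n→∞} lim_{d→∞} P[ |‖W² M (W²)ᵀ‖_F² / ‖M‖_F² − 1| > ε ] = 0` (iterated limit,
stated via the inner limits `L n`). -/
theorem outputHessian_projection_preserves_frobenius
    (c : ℕ) (hc : 2 ≤ c) (ε : ℝ) (hε : 0 < ε) :
    ∃ L : ℕ → ℝ≥0∞,
      (∀ n : ℕ,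
        Tendsto (fun d : ℕ =>
            weightMeasure c d n
              {w | ε <
                |frob2 (W2of w.2 * outputHessian c d n w * (W2of w.2)ᵀ) /
                    frob2 (outputHessian c d n w) - 1|})
          atTop (nhds (L n))) ∧
      Tendsto L atTop (nhds 0) := by
  obtain ⟨l, hl⟩ := tendsto_weightMeasure_zero c (ε := ε)
  refine ⟨fun n => if n = 0 then l else
    scaledGaussian c n {w | ε < |projRatio (W2of w) (limHess (W2of w)) - 1|}, fun n => ?_, ?_⟩
  · obtain rfl | hn := Nat.eq_zero_or_pos n
    · beta_reduce
      rw [if_pos rfl]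
      exact hl
    · beta_reduce
      rw [if_neg hn.ne']
      exact tendsto_weightMeasure hc hn hε
  · refine (tendsto_scaledGaussian_projRatio hc hε).congr' ?_
    filter_upwards [eventually_gt_atTop 0] with n hn
    simp only [hn.ne', if_false]
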